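/- arXiv:2004.14926 — 2 statements merged into one kernel-verified Lean document; each statement's English description precedes it below -/
import Mathlib

section
/- For every rational r ∈ 𝓔 ∩ ℚ and every δ > 0, dim_H(𝓔 ∩ (r−δ, r+δ)) > 1/2. -/
open Set Filter MeasureTheory
open scoped ENNReal

/-- The Tanaka–Ito `α`-continued fraction map. -/
noncomputable def T (α x : ℝ) : ℝ := if x = 0 then 0 else 1 / x - (⌊1 / x + 1 - α⌋ : ℝ)

/-- `J` is a matching interval with matching exponents `(M, N)`. -/
def IsMatchingInterval (J : Set ℝ) (M N : ℕ) : Prop :=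
  (∃ a b : ℝ, a < b ∧ J = Set.Ioo a b) ∧ J ⊆ Set.Icc 0 1 ∧
  (∀ α ∈ J, (T α)^[M] (α - 1) = (T α)^[N] α) ∧
  (∀ᵐ α ∂(volume.restrict J), (T α)^[M - 1] (α - 1) ≠ (T α)^[N - 1] α) ∧
  (∀ J' : Set ℝ, (∃ a b : ℝ, a < b ∧ J' = Set.Ioo a b) → J' ⊆ Set.Icc 0 1 →
    (∀ α ∈ J', (T α)^[M] (α - 1) = (T α)^[N] α) →
    (∀ᵐ α ∂(volume.restrict J'), (T α)^[M - 1] (α - 1) ≠ (T α)^[N - 1] α) →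
    J ⊆ J' → J' = J)

/-- The matching set: the union of all matching intervals. -/
def MatchingSet : Set ℝ := {x | ∃ (J : Set ℝ) (M N : ℕ), IsMatchingInterval J M N ∧ x ∈ J}

/-- The bifurcation set `𝓔`: the complement in `[0,1]` of the matching set. -/
def E : Set ℝ := Set.Icc 0 1 \ MatchingSet

theorem exists_continuedFraction {S : Type*} (G : S → S) (a : S → ℕ) (ha : ∀ u, 2 ≤ a u) :
    ∃ x : S → ℝ, ∀ u, 0 < x u ∧ x u = 1 / (a u + x (G u)) := by
  let y : ℕ → S → ℝ := fun n => Nat.rec (fun _ => 0) (fun _ z u => 1 / (a u + z (G u))) n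
  have hy : ∀ n u, y (n + 1) u = 1 / (a u + y n (G u)) := fun _ _ => rfl
  have ha' : ∀ u, (2 : ℝ) ≤ a u := fun u => by exact_mod_cast ha u
  have h0 : ∀ n u, 0 ≤ y n u := by
    intro n
    induction n with
    | zero => exact fun _ => le_rfl
    | succ n ih =>
      intro u
      rw [hy]
      have := ih (G u)
      positivity
  have hd : ∀ n u, dist (y n u) (y (n + 1) u) ≤ 1 * (1 / 4) ^ n := by
    intro n
    induction n with
    | zero =>
      intro u
      have h1 := ha' u
      have h2 : y 0 u = 0 := rfl
      have h3 : y 0 (G u) = 0 := rfl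
      rw [hy, h2, h3, dist_zero_left, Real.norm_of_nonneg (by positivity)]
      rw [pow_zero, mul_one, div_le_one (by positivity)]
      linarith
    | succ n ih =>
      intro u
      have h1 := ha' u
      have h2 := h0 n (G u)
      have h3 := h0 (n + 1) (G u)
      have h4 := ih (G u)
      rw [hy n, hy (n + 1)]
      rw [Real.dist_eq] at h4 ⊢
      rw [div_sub_div _ _ (by positivity) (by positivity), abs_div,
        abs_of_pos (a := (_ : ℝ) * _) (by positivity), div_le_iff₀ (by positivity)]
      have h5 : (4 : ℝ) ≤ (a u + y n (G u)) * (a u + y (n + 1) (G u)) := by nlinarith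
      have h6 : |1 * ((a u : ℝ) + y (n + 1) (G u)) - (a u + y n (G u)) * 1|
          = |y n (G u) - y (n + 1) (G u)| := by
        rw [abs_sub_comm]; congr 1; ring
      rw [h6, pow_succ]
      have h7 : (0 : ℝ) ≤ (1 / 4) ^ n := by positivity
      nlinarith
  have hlim : ∀ u, ∃ l, Tendsto (fun n => y n u) atTop (nhds l) := fun u =>
    cauchySeq_tendsto_of_complete
      (cauchySeq_of_le_geometric (1 / 4) 1 (by norm_num) (fun n => hd n u))
  choose x hx using hlim
  have hx0 : ∀ u, 0 ≤ x u := fun u => ge_of_tendsto' (hx u) (fun n => h0 n u)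
  have hxe : ∀ u, x u = 1 / (a u + x (G u)) := by
    intro u
    have h1 := ha' u
    have h2 := hx0 (G u)
    refine tendsto_nhds_unique ((tendsto_add_atTop_iff_nat 1).2 (hx u)) ?_
    exact Tendsto.div tendsto_const_nhds ((hx (G u)).const_add _) (by positivity)
  refine ⟨x, fun u => ⟨?_, hxe u⟩⟩
  have h1 := ha' u
  have h2 := hx0 (G u)
  rw [hxe]
  positivity

/-- A weight vector of total mass greater than one for an exponent larger than `1 / 2`. -/
theorem exists_exponent (D : ℕ) : ∃ (k : ℕ) (s : ℝ), 1 / 2 < s ∧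
    1 < ∑ j ∈ Finset.range k, ((((D + j : ℕ) : ℝ) + 1) ^ 2)⁻¹ ^ s := by
  obtain ⟨k, hk⟩ : ∃ k : ℕ, 1 < ∑ j ∈ Finset.range k, (((D + j : ℕ) : ℝ) + 1)⁻¹ := by
    have h := Real.tendsto_sum_range_one_div_nat_succ_atTop
    obtain ⟨n, hn, hDn⟩ := ((h.eventually_gt_atTop
      (1 + ∑ i ∈ Finset.range D, (1 / ((i : ℝ) + 1)))).and (eventually_ge_atTop D)).exists
    obtain ⟨k, rfl⟩ := Nat.exists_eq_add_of_le hDn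
    refine ⟨k, ?_⟩
    rw [Finset.sum_range_add] at hn
    simp only [one_div] at hn
    linarith
  have hc : Continuous fun s : ℝ =>
      ∑ j ∈ Finset.range k, ((((D + j : ℕ) : ℝ) + 1) ^ 2)⁻¹ ^ s := by
    refine continuous_finsetSum _ fun j _ => ?_
    exact Real.continuous_const_rpow (by positivity)
  have h1 : 1 < ∑ j ∈ Finset.range k, ((((D + j : ℕ) : ℝ) + 1) ^ 2)⁻¹ ^ (1 / 2 : ℝ) := by
    convert hk using 2 with j
    rw [← inv_pow, ← Real.sqrt_eq_rpow, Real.sqrt_sq (by positivity)]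
  have h2 := (hc.tendsto (1 / 2)).eventually (lt_mem_nhds h1)
  obtain ⟨s, hs, hs'⟩ := ((h2.filter_mono nhdsWithin_le_nhds).and
    (self_mem_nhdsWithin : Ioi (1 / 2 : ℝ) ∈ nhdsWithin (1 / 2 : ℝ) (Ioi (1/2)))).exists
  exact ⟨k, s, hs', hs⟩

/-- Coding of the unit interval by a finite probability vector. -/
theorem exists_subdivision (p : ℕ → ℝ) (hp : ∀ j, 0 < p j) (k : ℕ) (u : ℝ) (hu0 : 0 ≤ u)
    (hu : u < ∑ i ∈ Finset.range k, p i) :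
    ∃ j < k, ∃ v ∈ Ico (0 : ℝ) 1, u = ∑ i ∈ Finset.range j, p i + p j * v := by
  induction k with
  | zero => simp at hu; linarith
  | succ k ih =>
    rcases lt_or_ge u (∑ i ∈ Finset.range k, p i) with h | h
    · obtain ⟨j, hj, h⟩ := ih h
      exact ⟨j, by omega, h⟩
    · have := hp k
      rw [Finset.sum_range_succ] at hu
      refine ⟨k, by omega, (u - ∑ i ∈ Finset.range k, p i) / p k, ⟨?_, ?_⟩, ?_⟩
      · exact div_nonneg (by linarith) this.le
      · rw [div_lt_one this]; linarith
      · field_simp; ring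

theorem dimH_range_le_of_antiholder {S : Type*} (e x : S → ℝ) (C r : NNReal) (hr : 0 < r)
    (h : ∀ u v, |e u - e v| ≤ C * |x u - x v| ^ (r : ℝ)) :
    dimH (range e) ≤ dimH (range x) / r := by
  have hr' : (r : ℝ) ≠ 0 := by exact_mod_cast hr.ne'
  have hf : Function.FactorsThrough e x := by
    intro u v huv
    have := h u v
    rw [huv, sub_self, abs_zero, Real.zero_rpow hr', mul_zero] at this
    exact sub_eq_zero.1 (abs_nonpos_iff.1 this)
  have hext : ∀ u, Function.extend x e 0 (x u) = e u := fun u => hf.extend_apply 0 u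
  have himg : Function.extend x e 0 '' range x = range e := by
    rw [← range_comp]
    exact congrArg range (funext hext)
  rw [← himg]
  refine HolderOnWith.dimH_image_le (C := C) ?_ hr
  rintro _ ⟨u, rfl⟩ _ ⟨v, rfl⟩
  rw [hext, hext, edist_dist, edist_dist, Real.dist_eq, Real.dist_eq,
    ENNReal.ofReal_rpow_of_nonneg (abs_nonneg _) r.coe_nonneg, ← ENNReal.ofReal_coe_nnreal,
    ← ENNReal.ofReal_mul C.coe_nonneg]
  exact ENNReal.ofReal_le_ofReal (h u v)

/-- A lower bound due to Good: continued fractions whose digits are all at least `D` contain a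
self-similar family of dimension greater than `1 / 2`. -/
theorem exists_continuedFraction_set (D : ℕ) (hD : 2 ≤ D) :
    ∃ K : Set ℝ, 1 / 2 < dimH K ∧
      ∀ x ∈ K, 0 < x ∧ ∃ d : ℕ, D ≤ d ∧ ∃ x' ∈ K, x = 1 / (d + x') := by
  obtain ⟨k, s, hs, hW⟩ := exists_exponent D
  set w : ℕ → ℝ := fun j => ((((D + j : ℕ) : ℝ) + 1) ^ 2)⁻¹ ^ s with hw
  set W : ℝ := ∑ j ∈ Finset.range k, w j with hWdef
  have hw0 : ∀ j, 0 < w j := fun j => by positivity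
  have hw1 : ∀ j, w j ≤ 1 := fun j => by
    refine Real.rpow_le_one (by positivity) (inv_le_one_of_one_le₀ ?_) (by linarith)
    have : (0 : ℝ) ≤ ((D + j : ℕ) : ℝ) := Nat.cast_nonneg _
    nlinarith
  have hsum : ∑ j ∈ Finset.range k, w j / W = 1 := by
    rw [← Finset.sum_div, div_self (by linarith)]
  have hsub : ∀ u : Ico (0 : ℝ) 1, ∃ (j : ℕ) (v : Ico (0 : ℝ) 1), j < k ∧
      (u : ℝ) = ∑ i ∈ Finset.range j, w i / W + w j / W * v := by
    rintro ⟨u, hu⟩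
    obtain ⟨j, hj, v, hv, h⟩ := exists_subdivision (fun j => w j / W)
      (fun j => div_pos (hw0 j) (by linarith)) k u hu.1 (by rw [hsum]; exact hu.2)
    exact ⟨j, ⟨v, hv⟩, hj, h⟩
  choose dig G hdig hG using hsub
  obtain ⟨x, hx⟩ := exists_continuedFraction G (fun u => D + dig u) (fun u => by omega)
  have hx0 : ∀ u, 0 < x u := fun u => (hx u).1
  have hxe : ∀ u, x u = 1 / (((D + dig u : ℕ) : ℝ) + x (G u)) := fun u => (hx u).2
  have hdig2 : ∀ u, (2 : ℝ) ≤ ((D + dig u : ℕ) : ℝ) := fun u => by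
    exact_mod_cast (by omega : 2 ≤ D + dig u)
  have hx2 : ∀ u, x u ≤ 1 / 2 := fun u => by
    rw [hxe]
    have := hdig2 u
    have := hx0 (G u)
    exact one_div_le_one_div_of_le (by norm_num) (by linarith)
  set g : ℝ := (1 / 2) / (((D + k : ℕ) : ℝ) + 1) ^ 2 with hgdef
  have hg : 0 < g := by positivity
  have hgap : ∀ u v, dig u < dig v → g ≤ x u - x v := by
    intro u v huv
    have h1 := hdig2 u
    have h2 := hdig2 v
    have h3 := hx0 (G u)
    have h4 := hx0 (G v)
    have h5 := hx2 (G u)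
    have h6 := hx2 (G v)
    have h7 : ((D + dig u : ℕ) : ℝ) + 1 ≤ ((D + dig v : ℕ) : ℝ) := by
      exact_mod_cast (by omega : D + dig u + 1 ≤ D + dig v)
    have h8 : ((D + dig v : ℕ) : ℝ) ≤ ((D + k : ℕ) : ℝ) := by
      have := hdig v
      exact_mod_cast (by omega : D + dig v ≤ D + k)
    rw [hxe u, hxe v, div_sub_div _ _ (by linarith) (by linarith), hgdef]
    apply div_le_div₀
    · linarith
    · linarith
    · exact mul_pos (by linarith) (by linarith)
    · rw [sq]
      exact mul_le_mul (by linarith) (by linarith) (by linarith) (by linarith)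
  have hcontr : ∀ u v, dig u = dig v → w (dig u) * |x (G u) - x (G v)| ^ s ≤ |x u - x v| ^ s := by
    intro u v huv
    have h1 := hdig2 u
    have h3 := hx0 (G u)
    have h4 := hx0 (G v)
    have h5 := hx2 (G u)
    have h6 := hx2 (G v)
    rw [hw, ← Real.mul_rpow (by positivity) (abs_nonneg _)]
    refine Real.rpow_le_rpow (by positivity) ?_ (by linarith)
    rw [hxe u, hxe v, ← huv, div_sub_div _ _ (by linarith) (by linarith), abs_div,
      abs_of_pos (a := (_ : ℝ) * _) (by nlinarith), mul_comm, ← div_eq_mul_inv]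
    apply div_le_div₀ (abs_nonneg _)
    · rw [abs_sub_comm]
      apply le_of_eq
      congr 1
      ring
    · nlinarith
    · rw [sq]
      exact mul_le_mul (by linarith) (by linarith) (by linarith) (by linarith)
  have hWi : 0 < W⁻¹ := inv_pos.2 (zero_lt_one.trans hW)
  have hanti : ∀ n : ℕ, ∀ u v : Ico (0 : ℝ) 1, W⁻¹ ^ n < |(u : ℝ) - v| →
      |(u : ℝ) - v| ≤ (g⁻¹) ^ s * |x u - x v| ^ s := by
    have hbound : ∀ u v : Ico (0 : ℝ) 1, |(u : ℝ) - v| < 1 := by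
      rintro ⟨u, hu⟩ ⟨v, hv⟩
      rw [abs_lt]
      constructor <;> linarith [hu.1, hu.2, hv.1, hv.2]
    intro n
    induction n with
    | zero =>
      intro u v h
      have := hbound u v
      rw [pow_zero] at h
      linarith
    | succ n ih =>
      intro u v h
      by_cases huv : dig u = dig v
      · have e : (u : ℝ) - v = w (dig u) / W * (G u - G v) := by
          rw [hG u, hG v, ← huv]; ring
        have hp : 0 < w (dig u) / W := div_pos (hw0 _) (by linarith)
        have e' : |(u : ℝ) - v| = w (dig u) / W * |(G u : ℝ) - G v| := by
          rw [e, abs_mul, abs_of_pos hp]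
        have hp1 : w (dig u) / W ≤ W⁻¹ := by
          rw [div_eq_mul_inv]
          exact mul_le_of_le_one_left hWi.le (hw1 _)
        have hp2 : w (dig u) / W ≤ w (dig u) := div_le_self (hw0 _).le hW.le
        have h1 : W⁻¹ ^ n < |(G u : ℝ) - G v| := by
          rw [e', pow_succ] at h
          have := mul_le_mul_of_nonneg_right hp1 (abs_nonneg ((G u : ℝ) - G v))
          nlinarith
        have h2 := ih _ _ h1
        have h3 := hcontr u v huv
        have hgs : 0 < (g⁻¹) ^ s := by positivity
        rw [e']
        calc w (dig u) / W * |(G u : ℝ) - G v|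
            ≤ w (dig u) * ((g⁻¹) ^ s * |x (G u) - x (G v)| ^ s) :=
              mul_le_mul hp2 h2 (abs_nonneg _) (hw0 _).le
          _ = (g⁻¹) ^ s * (w (dig u) * |x (G u) - x (G v)| ^ s) := by ring
          _ ≤ _ := mul_le_mul_of_nonneg_left h3 hgs.le
      · have h1 : g ≤ |x u - x v| := by
          rcases lt_or_gt_of_ne huv with h | h
          · exact (hgap u v h).trans (le_abs_self _)
          · rw [abs_sub_comm]
            exact (hgap v u h).trans (le_abs_self _)
        rw [← Real.mul_rpow (by positivity) (abs_nonneg _)]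
        refine (hbound u v).le.trans (Real.one_le_rpow ?_ (by linarith))
        rw [inv_mul_eq_div, le_div_iff₀ hg]
        linarith
  refine ⟨range x, ?_, ?_⟩
  · have hs0 : 0 < s := by linarith
    obtain ⟨t, rfl⟩ : ∃ t : NNReal, (t : ℝ) = s := ⟨s.toNNReal, Real.coe_toNNReal _ hs0.le⟩
    obtain ⟨C, hC⟩ : ∃ C : NNReal, (C : ℝ) = (g⁻¹) ^ (t : ℝ) :=
      ⟨_, Real.coe_toNNReal _ (by positivity)⟩
    have ht0 : 0 < t := by exact_mod_cast hs0
    have h1 := dimH_range_le_of_antiholder (fun u : Ico (0 : ℝ) 1 => (u : ℝ)) x C t ht0 (by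
        intro u v
        rw [hC]
        rcases (abs_nonneg ((u : ℝ) - v)).eq_or_lt with h | h
        · rw [← h]; positivity
        · obtain ⟨n, hn⟩ := exists_pow_lt_of_lt_one h (inv_lt_one_of_one_lt₀ hW)
          exact hanti n u v hn)
    rw [Subtype.range_coe, Real.dimH_of_nonempty_interior (by simp)] at h1
    rw [ENNReal.le_div_iff_mul_le (Or.inl (by exact_mod_cast ht0.ne'))
      (Or.inl ENNReal.coe_ne_top)] at h1
    simp only [Module.finrank_self, Nat.cast_one, one_mul] at h1
    refine lt_of_lt_of_le ?_ h1
    have h2 : (1 / 2 : ENNReal) = ((1 / 2 : NNReal) : ENNReal) := by simp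
    rw [h2, ENNReal.coe_lt_coe, ← NNReal.coe_lt_coe]
    simpa using hs
  · rintro _ ⟨u, rfl⟩
    exact ⟨hx0 u, D + dig u, by omega, x (G u), ⟨_, rfl⟩, hxe u⟩

theorem dimH_le_dimH_mobius_image (P Q p q : ℝ) (hdet : (p * Q - q * P) ^ 2 = 1) (hQ : 0 < Q)
    (hq : 0 ≤ q) (K : Set ℝ) (hK : K ⊆ Ioo 0 1) :
    dimH K ≤ dimH ((fun ξ => (P + p * ξ) / (Q + q * ξ)) '' K) := by
  have h := dimH_range_le_of_antiholder (fun u : K => (u : ℝ))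
    (fun u : K => (P + p * (u : ℝ)) / (Q + q * (u : ℝ))) (((Q + q) ^ 2).toNNReal) 1 one_pos (by
      rintro ⟨u, hu⟩ ⟨v, hv⟩
      obtain ⟨hu0, hu1⟩ := hK hu
      obtain ⟨hv0, hv1⟩ := hK hv
      have h1 : 0 < Q + q * u := by positivity
      have h2 : 0 < Q + q * v := by positivity
      have h3 : Q + q * u ≤ Q + q := by nlinarith
      have h4 : Q + q * v ≤ Q + q := by nlinarith
      have e : (P + p * u) * (Q + q * v) - (Q + q * u) * (P + p * v)
          = (p * Q - q * P) * (u - v) := by ring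
      have hd : |p * Q - q * P| = 1 := by
        rcases mul_self_eq_one_iff.1 ((sq _).symm.trans hdet) with h | h <;> simp [h]
      simp only [NNReal.coe_one, Real.rpow_one]
      rw [Real.coe_toNNReal _ (by positivity), div_sub_div _ _ h1.ne' h2.ne', e, abs_div, abs_mul,
        hd, one_mul, abs_of_pos (mul_pos h1 h2), mul_div_assoc', le_div_iff₀ (mul_pos h1 h2),
        mul_comm, sq]
      exact mul_le_mul_of_nonneg_right (mul_le_mul h3 h4 h2.le (h1.le.trans h3)) (abs_nonneg _))
  rw [Subtype.range_coe, ENNReal.coe_one, div_one] at h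
  convert h using 2
  rw [image_eq_range]

theorem T_zero (α : ℝ) : T α 0 = 0 := if_pos rfl

theorem T_eq_of_inv {α x z : ℝ} (k : ℤ) (hx : x ≠ 0) (h : 1 / x = k + z) (h1 : α - 1 ≤ z)
    (h2 : z < α) : T α x = z := by
  have hk : ⌊1 / x + 1 - α⌋ = k := by
    rw [Int.floor_eq_iff, h]
    constructor <;> linarith
  rw [T, if_neg hx, hk, h]
  ring

theorem T_lt {α : ℝ} (hα : 0 < α) (x : ℝ) : T α x < α := by
  rw [T]
  split_ifs
  · exact hα
  · linarith [Int.lt_floor_add_one (1 / x + 1 - α)]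

theorem T_iterate_mem {α : ℝ} {K : Set ℝ} (hK : K ⊆ Ioo 0 (min α (1 - α)))
    (hKd : ∀ x ∈ K, ∃ d : ℤ, ∃ x' ∈ K, x = 1 / (d + x')) {σ : ℝ} (hσ : σ = 1 ∨ σ = -1) (i : ℕ) :
    ∀ x ∈ K, ∃ y ∈ K, (T α)^[i] (σ * x) = σ * y := by
  induction i with
  | zero => exact fun x hx => ⟨x, hx, rfl⟩
  | succ i ih =>
    intro x hx
    obtain ⟨d, x', hx', e⟩ := hKd x hx
    obtain ⟨y, hy, h⟩ := ih x' hx'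
    obtain ⟨h1, h2⟩ := hK hx'
    have h3 := lt_min_iff.1 h2
    refine ⟨y, hy, ?_⟩
    rw [Function.iterate_succ_apply, ← h]
    congr 1
    have hx0 : x ≠ 0 := (hK hx).1.ne'
    have hinv : 1 / x = d + x' := by rw [e, one_div_one_div]
    rcases hσ with rfl | rfl
    · simp only [one_mul]
      exact T_eq_of_inv d hx0 hinv (by linarith) h3.1
    · simp only [neg_one_mul]
      refine T_eq_of_inv (-d) (neg_ne_zero.2 hx0) ?_ (by linarith) (by linarith)
      rw [one_div_neg_eq_neg_one_div, hinv]
      push_cast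
      ring

/-- If the two critical orbits become opposite points of a set of positive continued fractions with
large digits, then they never meet. -/
theorem mem_E_of_opposite {α : ℝ} {K : Set ℝ} (hα : α ∈ Icc (0 : ℝ) 1)
    (hK : K ⊆ Ioo 0 (min α (1 - α)))
    (hKd : ∀ x ∈ K, ∃ d : ℤ, ∃ x' ∈ K, x = 1 / (d + x')) {σ : ℝ} (hσ : σ = 1 ∨ σ = -1) {x : ℝ}
    (hx : x ∈ K) (m n : ℕ) (hm : (T α)^[m] (α - 1) = σ * x) (hn : (T α)^[n] α = -σ * x) :
    α ∈ E := by
  refine ⟨hα, ?_⟩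
  rintro ⟨J, M, N, ⟨-, -, hJ, -⟩, hαJ⟩
  have h := congrArg (T α)^[m + n] (hJ α hαJ)
  rw [← Function.iterate_add_apply, ← Function.iterate_add_apply,
    show m + n + M = (n + M) + m by ring, show m + n + N = (m + N) + n by ring,
    Function.iterate_add_apply _ (n + M), Function.iterate_add_apply _ (m + N), hm, hn] at h
  obtain ⟨y, hy, e⟩ := T_iterate_mem hK hKd hσ (n + M) x hx
  obtain ⟨z, hz, e'⟩ := T_iterate_mem hK hKd (σ := -σ)
    (by rcases hσ with rfl | rfl <;> simp) (m + N) x hx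
  rw [e, e'] at h
  have h1 := (hK hy).1
  have h2 := (hK hz).1
  rcases hσ with rfl | rfl <;> linarith

theorem orbit_structure_of_zero {p q : ℤ} (hp : 0 < p) (hpq : p < q) (hcop : IsCoprime p q)
    {g : ℝ → ℝ} {a b c d : ℤ} (hdet : (a * d - b * c) ^ 2 = 1) (h0 : a * p + b * q = 0)
    (hg : ∀ᶠ α in nhds (p / q : ℝ), g α = (a * α + b) / (c * α + d)) :
    (∀ i, 1 ≤ i → (T (p / q))^[i] (g (p / q)) ≠ p / q - 1) ∧
      ∃ c d : ℤ, (c * p + d * q) ^ 2 = 1 ∧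
        ∀ᶠ α in nhds (p / q : ℝ), g α = (q * α - p) / (c * α + d) := by
  have hq0 : (0 : ℝ) < q := by exact_mod_cast hp.trans hpq
  obtain ⟨e, rfl⟩ : q ∣ a := hcop.symm.dvd_of_dvd_mul_right ⟨-b, by linarith⟩
  obtain rfl : b = -(e * p) := by
    have : q * (b + e * p) = 0 := by linarith
    rcases mul_eq_zero.1 this with h | h <;> linarith
  have hee : e * (d * q + p * c) * (e * (d * q + p * c)) = 1 := by rw [← hdet]; ring
  have he : e = 1 ∨ e = -1 := Int.isUnit_iff.1
    (IsUnit.of_mul_eq_one ((d * q + p * c) * (e * (d * q + p * c))) (by rw [← hee]; ring))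
  constructor
  · intro i _
    have : g (p / q) = 0 := by
      rw [hg.self_of_nhds]
      push_cast
      rw [show (q * e * (p / q) + -(e * p) : ℝ) = 0 by field_simp; ring, zero_div]
    rw [this, Function.iterate_fixed (T_zero _)]
    have : (p / q : ℝ) < 1 := by rw [div_lt_one hq0]; exact_mod_cast hpq
    intro h
    linarith
  · refine ⟨e * c, e * d, ?_, ?_⟩
    · rw [← hdet]
      ring
    · filter_upwards [hg] with α h
      rw [h]
      push_cast
      rcases he with rfl | rfl
      · congr 1 <;> push_cast <;> ring
      · rw [← neg_div_neg_eq]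
        congr 1 <;> push_cast <;> ring

/-- Along the orbit of a rational number, the iterates depend analytically on the parameter until
they hit zero, where they vanish like an integral Möbius map. -/
theorem orbit_structure {p q : ℤ} (hp : 0 < p) (hpq : p < q) (hcop : IsCoprime p q) (n : ℕ) :
    ∀ (g : ℝ → ℝ) (a b c d : ℤ), (a * d - b * c) ^ 2 = 1 → |a * p + b * q| ≤ n →
      |a * p + b * q| < |c * p + d * q| → |c * p + d * q| ≤ q →
      (∀ᶠ α in nhds (p / q : ℝ), g α = (a * α + b) / (c * α + d)) →
      ∃ m : ℕ, (∀ i ≤ m, AnalyticAt ℝ (fun α => (T α)^[i] (g α)) (p / q)) ∧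
        (∀ i, 1 ≤ i → (T (p / q))^[i] (g (p / q)) ≠ p / q - 1) ∧
        ∃ c d : ℤ, (c * p + d * q) ^ 2 = 1 ∧
          ∀ᶠ α in nhds (p / q : ℝ), (T α)^[m] (g α) = (q * α - p) / (c * α + d) := by
  have hq0 : (0 : ℝ) < q := by exact_mod_cast hp.trans hpq
  have hval : ∀ a b : ℤ, (a * (p / q) + b : ℝ) = ((a * p + b * q : ℤ) : ℝ) / q := by
    intro a b
    push_cast
    field_simp
  have hana : ∀ (g : ℝ → ℝ) (a b c d : ℤ), c * p + d * q ≠ 0 →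
      (∀ᶠ α in nhds (p / q : ℝ), g α = (a * α + b) / (c * α + d)) → AnalyticAt ℝ g (p / q) := by
    intro g a b c d hne hg
    refine AnalyticAt.congr ?_ (hg.mono fun _ h => h.symm)
    refine AnalyticAt.div (by fun_prop) (by fun_prop) ?_
    rw [hval]
    exact div_ne_zero (by exact_mod_cast hne) hq0.ne'
  induction n with
  | zero =>
    intro g a b c d hdet hn hlt _ hg
    have h0 : a * p + b * q = 0 := abs_nonpos_iff.1 (by exact_mod_cast hn)
    refine ⟨0, fun i hi => ?_, orbit_structure_of_zero hp hpq hcop hdet h0 hg⟩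
    obtain rfl : i = 0 := by omega
    exact hana g a b c d (abs_pos.1 ((abs_nonneg _).trans_lt hlt)) hg
  | succ n ih =>
    intro g a b c d hdet hn hlt hle hg
    have hY : c * p + d * q ≠ 0 := abs_pos.1 ((abs_nonneg _).trans_lt hlt)
    have hgA := hana g a b c d hY hg
    by_cases h0 : a * p + b * q = 0
    · refine ⟨0, fun i hi => ?_, orbit_structure_of_zero hp hpq hcop hdet h0 hg⟩
      obtain rfl : i = 0 := by omega
      exact hgA
    have hXr : ((a * p + b * q : ℤ) : ℝ) ≠ 0 := by exact_mod_cast h0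
    have hYr : ((c * p + d * q : ℤ) : ℝ) ≠ 0 := by exact_mod_cast hY
    have hr0 : (0 : ℝ) < p / q := div_pos (by exact_mod_cast hp) hq0
    have hr1 : (p / q : ℝ) < 1 := by rw [div_lt_one hq0]; exact_mod_cast hpq
    set w : ℝ := (c * (p / q) + d) / (a * (p / q) + b) with hw
    have hwXY : w * ((a * p + b * q : ℤ) : ℝ) = ((c * p + d * q : ℤ) : ℝ) := by
      rw [hw, hval, hval]
      field_simp
    set k : ℤ := ⌊w + 1 - p / q⌋ with hk
    have hk1 : (k : ℝ) ≤ w + 1 - p / q := Int.floor_le _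
    have hk2 : w + 1 - p / q < k + 1 := Int.lt_floor_add_one _
    have hkne : (k : ℝ) ≠ w + 1 - p / q := by
      intro h
      have e1 : q * (c * p + d * q) = (a * p + b * q) * (k * q + p - q) := by
        have : (q : ℝ) * ((c * p + d * q : ℤ) : ℝ)
            = ((a * p + b * q : ℤ) : ℝ) * (k * q + p - q) := by
          rw [← hwXY, show w = k - 1 + p / q by linarith]
          field_simp
          ring
        exact_mod_cast this
      have e2 : q ∣ a * p + b * q := by
        refine hcop.symm.dvd_of_dvd_mul_right
          ⟨(c * p + d * q) - (a * p + b * q) * (k - 1), ?_⟩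
        linear_combination -e1
      have e3 := Int.le_of_dvd (abs_pos.2 h0) ((dvd_abs _ _).2 e2)
      linarith
    have hk1' : (k : ℝ) < w + 1 - p / q := lt_of_le_of_ne hk1 hkne
    have hcont1 : ContinuousAt (fun α : ℝ => (c : ℝ) * α + d) (p / q) := by fun_prop
    have hcont2 : ContinuousAt (fun α : ℝ => (a : ℝ) * α + b) (p / q) := by fun_prop
    have hv1 : (c * (p / q) + d : ℝ) ≠ 0 := by rw [hval]; exact div_ne_zero hYr hq0.ne'
    have hv2 : (a * (p / q) + b : ℝ) ≠ 0 := by rw [hval]; exact div_ne_zero hXr hq0.ne'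
    have hcont3 : ContinuousAt (fun α : ℝ => (c * α + d) / (a * α + b) + 1 - α) (p / q) :=
      ((hcont1.div hcont2 hv2).add continuousAt_const).sub continuousAt_id
    have hTg : ∀ᶠ α in nhds (p / q : ℝ), T α (g α)
        = ((c - k * a : ℤ) * α + (d - k * b : ℤ)) / (a * α + b) := by
      filter_upwards [hg, hcont1.eventually_ne hv1, hcont2.eventually_ne hv2,
        hcont3.eventually (lt_mem_nhds hk1'), hcont3.eventually (gt_mem_nhds hk2)]
        with α h1 h2 h3 h4 h5
      have e : (c * α + d) / (a * α + b)
          = k + ((c - k * a : ℤ) * α + (d - k * b : ℤ)) / (a * α + b) := by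
        rw [div_eq_iff h3, add_mul, div_mul_cancel₀ _ h3]
        push_cast
        ring
      refine T_eq_of_inv k ?_ ?_ ?_ ?_
      · rw [h1]
        exact div_ne_zero h3 h2
      · rw [h1, one_div_div, e]
      · linarith
      · linarith
    have hnew : |(c - k * a) * p + (d - k * b) * q| < |a * p + b * q| := by
      have e : (((c - k * a) * p + (d - k * b) * q : ℤ) : ℝ)
          = (w - k) * ((a * p + b * q : ℤ) : ℝ) := by
        rw [sub_mul w, hwXY]
        push_cast
        ring
      have : |(((c - k * a) * p + (d - k * b) * q : ℤ) : ℝ)| < |((a * p + b * q : ℤ) : ℝ)| := by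
        rw [e, abs_mul]
        refine mul_lt_of_lt_one_left (abs_pos.2 hXr) ?_
        rw [abs_lt]
        constructor <;> linarith
      exact_mod_cast this
    obtain ⟨m, hm1, hm2, hm3⟩ := ih (fun α => T α (g α)) (c - k * a) (d - k * b) a b
      (by rw [← hdet]; ring) (by push_cast at hn; linarith) hnew (by linarith) hTg
    refine ⟨m + 1, ?_, ?_, hm3⟩
    · rintro (_ | i) hi
      · exact hgA
      · exact hm1 i (by omega)
    · rintro (_ | _ | i) hi
      · omega
      · simp only [Function.iterate_succ, Function.iterate_zero, Function.comp_apply, id]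
        rw [T, if_neg]
        · rw [hg.self_of_nhds, one_div_div, ← hw, ← hk]
          intro h
          exact hkne (by linarith)
        · rw [hg.self_of_nhds]
          exact div_ne_zero hv2 hv1
      · exact hm2 (i + 1) (by omega)

theorem T_eq_T_of_inv_sub {α x y : ℝ} (l : ℤ) (hx : x ≠ 0) (hy : y ≠ 0)
    (h : 1 / x = 1 / y + l) : T α x = T α y := by
  rw [T, T, if_neg hx, if_neg hy, h, show 1 / y + (l : ℝ) + 1 - α = 1 / y + 1 - α + l by ring,
    Int.floor_add_intCast]
  push_cast
  ring

/-- Matching near an interior point extends to a matching interval around it. -/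
theorem mem_matchingSet_of_eventually {r : ℝ} (hr : r ∈ Ioo (0 : ℝ) 1) {M N : ℕ}
    (heq : ∀ᶠ α in nhds r, (T α)^[M] (α - 1) = (T α)^[N] α)
    (hne : ∀ᶠ α in nhdsWithin r {r}ᶜ, (T α)^[M - 1] (α - 1) ≠ (T α)^[N - 1] α) :
    r ∈ MatchingSet := by
  let F : Set (Set ℝ) := {J | (∃ a b : ℝ, a < b ∧ J = Ioo a b) ∧ J ⊆ Icc 0 1 ∧
    (∀ α ∈ J, (T α)^[M] (α - 1) = (T α)^[N] α) ∧
    (∀ᵐ α ∂(volume.restrict J), (T α)^[M - 1] (α - 1) ≠ (T α)^[N - 1] α) ∧ r ∈ J}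
  obtain ⟨J₀, hJ₀⟩ : F.Nonempty := by
    obtain ⟨a, b, hab, h⟩ := mem_nhds_iff_exists_Ioo_subset.1
      ((heq.and (eventually_nhdsWithin_iff.1 hne)).and (Ioo_mem_nhds hr.1 hr.2))
    refine ⟨Ioo a b, ⟨a, b, hab.1.trans hab.2, rfl⟩, fun α hα => Ioo_subset_Icc_self (h hα).2,
      fun α hα => (h hα).1.1, ?_, hab⟩
    rw [ae_restrict_iff' measurableSet_Ioo]
    filter_upwards [compl_mem_ae_iff.2 (measure_singleton r)] with α hα hαJ
    exact (h hαJ).1.2 hα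
  have hop : ∀ J ∈ F, IsOpen J := by
    rintro _ ⟨⟨a, b, -, rfl⟩, -⟩
    exact isOpen_Ioo
  have hopen : IsOpen (⋃₀ F) := isOpen_sUnion hop
  have hrF : r ∈ ⋃₀ F := ⟨J₀, hJ₀, hJ₀.2.2.2.2⟩
  have hsub : ⋃₀ F ⊆ Icc 0 1 := sUnion_subset fun J hJ => hJ.2.1
  have hbelow : BddBelow (⋃₀ F) := bddBelow_Icc.mono hsub
  have habove : BddAbove (⋃₀ F) := bddAbove_Icc.mono hsub
  have hconn : IsConnected (⋃₀ F) := by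
    refine ⟨⟨r, hrF⟩, isPreconnected_sUnion r F (fun J hJ => hJ.2.2.2.2) ?_⟩
    rintro _ ⟨⟨a, b, -, rfl⟩, -⟩
    exact isPreconnected_Ioo
  have hIoo : ⋃₀ F = Ioo (sInf (⋃₀ F)) (sSup (⋃₀ F)) := by
    refine Subset.antisymm ?_ (hconn.Ioo_csInf_csSup_subset hbelow habove)
    intro x hx
    obtain ⟨a, b, hab, h⟩ := mem_nhds_iff_exists_Ioo_subset.1 (hopen.mem_nhds hx)
    obtain ⟨y, hy1, hy2⟩ := exists_between hab.1
    obtain ⟨z, hz1, hz2⟩ := exists_between hab.2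
    exact ⟨(csInf_le hbelow (h ⟨hy1, hy2.trans hab.2⟩)).trans_lt hy2,
      hz1.trans_le (le_csSup habove (h ⟨hab.1.trans hz1, hz2⟩))⟩
  refine ⟨⋃₀ F, M, N, ⟨?_, hsub, ?_, ?_, ?_⟩, hrF⟩
  · refine ⟨_, _, ?_, hIoo⟩
    rw [hIoo] at hrF
    exact hrF.1.trans hrF.2
  · rintro α ⟨J, hJ, hα⟩
    exact hJ.2.2.1 α hα
  · obtain ⟨S, hS, hSF, e⟩ := TopologicalSpace.isOpen_sUnion_countable F hop
    rw [← e, sUnion_eq_biUnion, ae_restrict_biUnion_iff _ hS]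
    exact fun J hJ => (hSF hJ).2.2.2.1
  · intro J' h1 h2 h3 h4 h5
    exact Subset.antisymm (subset_sUnion_of_mem ⟨h1, h2, h3, h4, h5 hrF⟩) h5

/-- A coincidence of the critical orbits near a rational number can be pulled back to a first
coincidence. -/
theorem exists_first_coincidence {r : ℝ} (hr : r ∈ Ioo (0 : ℝ) 1) {m n : ℕ}
    (hm : ∀ i ≤ m, AnalyticAt ℝ (fun α => (T α)^[i] (α - 1)) r)
    (hn : ∀ i ≤ n, AnalyticAt ℝ (fun α => (T α)^[i] α) r)
    (hne : ∀ i, 1 ≤ i → (T r)^[i] r ≠ r - 1) :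
    ∀ M N : ℕ, M ≤ m + 1 → N ≤ n + 1 →
      (∀ᶠ α in nhds r, (T α)^[M] (α - 1) = (T α)^[N] α) → r ∈ MatchingSet := by
  intro M
  induction M with
  | zero =>
    rintro (_ | N) _ _ h
    · have := h.self_of_nhds
      simp at this
    · exact absurd h.self_of_nhds.symm (hne (N + 1) (by omega))
  | succ M ih =>
    rintro (_ | N) hM hN h
    · have h1 := h.self_of_nhds
      rw [Function.iterate_succ_apply'] at h1
      exact absurd h1 (T_lt hr.1 _).ne
    · rcases (hm M (by omega)).eventually_eq_or_eventually_ne (hn N (by omega)) with h1 | h1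
      · exact ih N (by omega) (by omega) h1
      · exact mem_matchingSet_of_eventually hr h h1

/-- The two critical orbits of an interior rational point of the bifurcation set end with opposite
branches. -/
theorem exists_opposite_branches {p q : ℤ} (hp : 0 < p) (hpq : p < q) (hcop : IsCoprime p q)
    (hE : (p / q : ℝ) ∈ E) : ∃ (m n : ℕ) (c d l : ℤ), (c * p + d * q) ^ 2 = 1 ∧
      ∀ᶠ α in nhds (p / q : ℝ), (T α)^[m] (α - 1) = (q * α - p) / (c * α + d) ∧
        (T α)^[n] α = (q * α - p) / (l * (q * α - p) - (c * α + d)) := by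
  have hq0 : (0 : ℝ) < q := by exact_mod_cast hp.trans hpq
  have hqZ : q ≠ 0 := (hp.trans hpq).ne'
  have hr : (p / q : ℝ) ∈ Ioo (0 : ℝ) 1 :=
    ⟨div_pos (by exact_mod_cast hp) hq0, by rw [div_lt_one hq0]; exact_mod_cast hpq⟩
  obtain ⟨m, hm1, -, c, d, hcd, hm3⟩ := orbit_structure hp hpq hcop (q - p).toNat
    (fun α => α - 1) 1 (-1) 0 1 (by norm_num)
    (by rw [Int.toNat_of_nonneg (by linarith), abs_le]; constructor <;> linarith)
    (by rw [abs_of_pos (a := 0 * p + 1 * q) (by linarith), abs_lt]; constructor <;> linarith)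
    (by rw [abs_of_pos (by linarith)]; linarith)
    (Eventually.of_forall fun α => by push_cast; ring)
  obtain ⟨n, hn1, hn2, c', d', hcd', hn3⟩ := orbit_structure hp hpq hcop p.toNat
    (fun α => α) 1 0 0 1 (by norm_num)
    (by rw [Int.toNat_of_nonneg (by linarith), abs_le]; constructor <;> linarith)
    (by rw [abs_of_pos (a := 0 * p + 1 * q) (by linarith), abs_lt]; constructor <;> linarith)
    (by rw [abs_of_pos (by linarith)]; linarith)
    (Eventually.of_forall fun α => by push_cast; ring)
  have hne : ∀ c d : ℤ, (c * p + d * q) ^ 2 = 1 →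
      ∀ᶠ α in nhds (p / q : ℝ), (c * α + d : ℝ) ≠ 0 := by
    intro c d h
    have hcont : ContinuousAt (fun α : ℝ => (c : ℝ) * α + d) (p / q) := by fun_prop
    refine hcont.eventually_ne fun h0 => ?_
    have h1 : (c * p + d * q : ℝ) = 0 := by
      field_simp at h0
      linarith
    have h2 : c * p + d * q = 0 := by exact_mod_cast h1
    rw [h2] at h
    norm_num at h
  have hl : ∀ s t : ℤ, s * p + t * q = 0 → ∃ l : ℤ, s = l * q ∧ t = -(l * p) := by
    intro s t h
    obtain ⟨l, rfl⟩ : q ∣ s := hcop.symm.dvd_of_dvd_mul_right ⟨-t, by linarith⟩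
    refine ⟨l, mul_comm _ _, ?_⟩
    have : q * (t + l * p) = 0 := by linarith
    rcases mul_eq_zero.1 this with h | h
    · exact absurd h hqZ
    · linarith
  rcases sq_eq_sq_iff_eq_or_eq_neg.1 (hcd.trans hcd'.symm) with h | h
  · exfalso
    obtain ⟨l, hl1, hl2⟩ := hl (c - c') (d - d') (by linarith)
    refine hE.2 (exists_first_coincidence hr hm1 hn1 hn2 (m + 1) (n + 1) le_rfl le_rfl ?_)
    filter_upwards [hm3, hn3, hne c d hcd, hne c' d' hcd'] with α h1 h2 h3 h4
    rw [Function.iterate_succ_apply', Function.iterate_succ_apply', h1, h2]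
    by_cases h0 : (q * α - p : ℝ) = 0
    · rw [h0, zero_div, zero_div]
    · refine T_eq_T_of_inv_sub l (div_ne_zero h0 h3) (div_ne_zero h0 h4) ?_
      have e1 : (c : ℝ) = c' + l * q := by exact_mod_cast (by linarith : c = c' + l * q)
      have e2 : (d : ℝ) = d' - l * p := by exact_mod_cast (by linarith : d = d' - l * p)
      rw [one_div_div, one_div_div, div_add' _ _ _ h0, e1, e2]
      congr 1
      ring
  · obtain ⟨l, hl1, hl2⟩ := hl (c + c') (d + d') (by linarith)
    refine ⟨m, n, c, d, l, hcd, ?_⟩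
    filter_upwards [hm3, hn3] with α h1 h2
    refine ⟨h1, ?_⟩
    rw [h2]
    congr 1
    have e1 : (c' : ℝ) = l * q - c := by exact_mod_cast (by linarith : c' = l * q - c)
    have e2 : (d' : ℝ) = -(l * p) - d := by exact_mod_cast (by linarith : d' = -(l * p) - d)
    rw [e1, e2]
    ring

/-- A family of continued fractions of dimension greater than `1 / 2`, invariant under the shift and
as close to zero as desired. -/
theorem exists_small_invariant_set (D : ℕ) (hD : 2 ≤ D) :
    ∃ K : Set ℝ, 1 / 2 < dimH K ∧ K ⊆ Ioo 0 (1 / (D : ℝ)) ∧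
      ∀ x ∈ K, ∃ d : ℤ, ∃ x' ∈ K, x = 1 / (d + x') := by
  obtain ⟨K, hK, h⟩ := exists_continuedFraction_set D hD
  refine ⟨K, hK, fun x hx => ?_, fun x hx => ?_⟩
  · obtain ⟨h0, d, hd, x', hx', e⟩ := h x hx
    have hd' : (D : ℝ) ≤ d := by exact_mod_cast hd
    have hD' : (0 : ℝ) < D := by exact_mod_cast (by omega : 0 < D)
    refine ⟨h0, ?_⟩
    rw [e]
    exact one_div_lt_one_div_of_lt hD' (by linarith [(h x' hx').1])
  · obtain ⟨h0, d, hd, x', hx', e⟩ := h x hx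
    exact ⟨d, x', hx', by exact_mod_cast e⟩

theorem dimH_E_near_of_mem_Ioo {p q : ℤ} (hp : 0 < p) (hpq : p < q) (hcop : IsCoprime p q)
    (hE : (p / q : ℝ) ∈ E) {δ : ℝ} (hδ : 0 < δ) :
    1 / 2 < dimH (E ∩ Ioo (p / q - δ : ℝ) (p / q + δ)) := by
  obtain ⟨m, n, c, d, l, hcd, hev⟩ := exists_opposite_branches hp hpq hcop hE
  have hq0 : (0 : ℝ) < q := by exact_mod_cast hp.trans hpq
  have hq1 : (1 : ℝ) ≤ q := by exact_mod_cast (by linarith : 1 ≤ q)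
  have hr0 : (0 : ℝ) < p / q := div_pos (by exact_mod_cast hp) hq0
  have hr1 : (p / q : ℝ) < 1 := by rw [div_lt_one hq0]; exact_mod_cast hpq
  set r : ℝ := p / q with hr
  have hqr : q * r = p := by rw [hr]; field_simp
  set s : ℝ := min r (1 - r) / 2 with hs
  have hs0 : 0 < s := half_pos (lt_min hr0 (by linarith))
  have hsr : 2 * s ≤ r := by rw [hs]; linarith [min_le_left r (1 - r)]
  have hsr' : 2 * s ≤ 1 - r := by rw [hs]; linarith [min_le_right r (1 - r)]
  obtain ⟨η, hη, hball⟩ := Metric.eventually_nhds_iff.1 hev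
  obtain ⟨D, hD⟩ := exists_nat_gt (max 2 (1 / s))
  have hD2 : (2 : ℝ) < D := (le_max_left _ _).trans_lt hD
  have hDs : 1 / (D : ℝ) < s := by
    rw [one_div_lt (by linarith) hs0]
    exact (le_max_right _ _).trans_lt hD
  obtain ⟨K, hKdim, hKsub, hKd⟩ := exists_small_invariant_set D (by exact_mod_cast hD2.le)
  set ζ : ℝ := min (min η δ) s with hζ
  have hζ0 : 0 < ζ := lt_min (lt_min hη hδ) hs0
  obtain ⟨L, hL⟩ := exists_nat_gt (|(c : ℝ)| + |(l : ℝ)| + 1 / ζ)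
  have hζi : 0 < 1 / ζ := one_div_pos.2 hζ0
  have hLl : (l : ℝ) < L := by linarith [le_abs_self (l : ℝ), abs_nonneg (c : ℝ)]
  have hL0 : (0 : ℝ) < L := by linarith [abs_nonneg (l : ℝ), abs_nonneg (c : ℝ)]
  have hQ : 1 / ζ < L * q - c := by
    have : (L : ℝ) ≤ L * q := le_mul_of_one_le_right hL0.le hq1
    linarith [abs_nonneg (l : ℝ), le_abs_self (c : ℝ)]
  have hcd' : ((c : ℝ) * p + d * q) ^ 2 = 1 := by exact_mod_cast hcd
  have hK1 : K ⊆ Ioo 0 1 := fun x hx => ⟨(hKsub hx).1, by linarith [(hKsub hx).2]⟩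
  refine (hKdim.trans_le (dimH_le_dimH_mobius_image (d + L * p) (L * q - c) p q
    (by rw [← hcd']; ring) (hζi.trans hQ) hq0.le K hK1)).trans_le (dimH_mono ?_)
  rintro _ ⟨ξ, hξ, rfl⟩
  have hξ0 : 0 < ξ := (hKsub hξ).1
  have hξ1 : ξ < s := (hKsub hξ).2.trans hDs
  set B : ℝ := L * q - c + q * ξ with hB
  have hBζ : 1 / ζ < B := by rw [hB]; nlinarith
  have hB0 : 0 < B := hζi.trans hBζ
  set ε : ℝ := c * p + d * q with hε
  have hε0 : ε ≠ 0 := by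
    intro h
    rw [h] at hcd'
    norm_num at hcd'
  set α : ℝ := (d + L * p + p * ξ) / B with hα
  have e1 : q * α - p = ε / B := by
    rw [hα, hε]
    field_simp
    rw [hB]
    ring
  have e2 : c * α + d = ε * (L + ξ) / B := by
    rw [hα, hε]
    field_simp
    rw [hB]
    ring
  have hdist : |α - r| < ζ := by
    have h1 : α - r = ε / B / q := by
      rw [← e1, ← hqr]
      field_simp
    have h2 : |ε| = 1 := by
      rcases mul_self_eq_one_iff.1 ((sq _).symm.trans hcd') with h | h <;> simp [h]
    rw [h1, abs_div, abs_div, h2, abs_of_pos hB0, abs_of_pos hq0]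
    calc 1 / B / q ≤ 1 / B := div_le_self (by positivity) hq1
      _ < ζ := by rwa [one_div_lt hB0 hζ0]
  have hdη : |α - r| < η := hdist.trans_le ((min_le_left _ _).trans (min_le_left _ _))
  have hdδ := abs_lt.1 (hdist.trans_le ((min_le_left _ _).trans (min_le_right _ _)))
  have hds := abs_lt.1 (hdist.trans_le (min_le_right _ _))
  refine ⟨?_, by linarith, by linarith⟩
  obtain ⟨hx, hy⟩ := hball hdη
  rw [e1, e2] at hx hy
  refine mem_E_of_opposite (σ := 1) ⟨by linarith, by linarith⟩ (fun x hx => ⟨(hKsub hx).1, ?_⟩)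
    hKd (Or.inl rfl) hξ (m + 1) (n + 1) ?_ ?_
  · have := (hKsub hx).2
    exact lt_min (by linarith) (by linarith)
  · rw [Function.iterate_succ_apply', hx, one_mul]
    refine T_eq_of_inv L ?_ ?_ (by linarith) (by linarith)
    · have : (L : ℝ) + ξ ≠ 0 := by positivity
      positivity
    · push_cast
      field_simp
  · rw [Function.iterate_succ_apply', hy, neg_one_mul]
    have h0 : l - L - ξ ≠ 0 := by
      intro h
      linarith
    have e3 : l * (ε / B) - ε * (L + ξ) / B = ε * (l - L - ξ) / B := by ring
    rw [e3]
    refine T_eq_of_inv (l - L) ?_ ?_ (by linarith) (by linarith)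
    · exact div_ne_zero (div_ne_zero hε0 hB0.ne') (div_ne_zero (mul_ne_zero hε0 h0) hB0.ne')
    · rw [one_div_div, div_div_div_cancel_right₀ hB0.ne', mul_div_cancel_left₀ _ hε0]
      push_cast
      ring

/-- Reciprocals of continued fractions, one digit below the threshold, serve as parameters at both
ends of the parameter interval. -/
theorem exists_endpoint_family {δ : ℝ} (hδ : 0 < δ) : ∃ (D : ℕ) (K : Set ℝ), 1 / 2 < dimH K ∧
    K ⊆ Ioo 0 1 ∧ (4 : ℝ) ≤ D ∧ 1 / ((D : ℝ) - 1) < δ ∧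
    (∀ x ∈ K, ∃ d : ℤ, ∃ x' ∈ K, x = 1 / (d + x')) ∧
    ∀ ξ ∈ K, K ⊆ Ioo 0 (1 / ((D : ℝ) - 1 + ξ)) := by
  obtain ⟨D, hD⟩ := exists_nat_gt (max 4 (1 / δ + 1))
  have hD4 : (4 : ℝ) < D := (le_max_left _ _).trans_lt hD
  have hDδ : 1 / δ + 1 < D := (le_max_right _ _).trans_lt hD
  have hD4' : 4 < D := by exact_mod_cast hD4
  obtain ⟨K, hKdim, hKsub, hKd⟩ := exists_small_invariant_set D (by omega)
  have hK1 : K ⊆ Ioo 0 1 := fun x hx =>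
    ⟨(hKsub hx).1, (hKsub hx).2.trans (by rw [div_lt_one] <;> linarith)⟩
  refine ⟨D, K, hKdim, hK1, hD4.le, ?_, hKd, fun ξ hξ x hx => ⟨(hKsub hx).1, ?_⟩⟩
  · rw [one_div_lt (by linarith) hδ]
    linarith
  · have := hK1 hξ
    exact (hKsub hx).2.trans (one_div_lt_one_div_of_lt (by linarith [this.1]) (by linarith [this.2]))

theorem dimH_E_near_zero {δ : ℝ} (hδ : 0 < δ) : 1 / 2 < dimH (E ∩ Ioo (0 - δ) (0 + δ)) := by
  obtain ⟨D, K, hKdim, hK1, hD, hDδ, hKd, hKsub⟩ := exists_endpoint_family hδ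
  refine (hKdim.trans_le (dimH_le_dimH_mobius_image 1 (D - 1) 0 1
    (by ring) (by linarith) zero_le_one K hK1)).trans_le (dimH_mono ?_)
  rintro _ ⟨ξ, hξ, rfl⟩
  simp only [zero_mul, add_zero, one_mul]
  have hξ0 := (hK1 hξ).1
  have hξs := (hKsub ξ hξ hξ).2
  have hsub := hKsub ξ hξ
  set w : ℝ := D - 1 + ξ with hw
  have hw3 : 3 < w := by linarith
  have hwi : 1 / w < 1 / 3 := one_div_lt_one_div_of_lt (by norm_num) hw3
  have hwi0 : 0 < 1 / w := by positivity
  have hwD : 1 / w < 1 / ((D : ℝ) - 1) := one_div_lt_one_div_of_lt (by linarith) (by linarith)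
  have hw1 : 0 < 1 / (w - 1) := one_div_pos.2 (by linarith)
  have hw2 : 1 / (w - 1) < 1 / 2 := one_div_lt_one_div_of_lt (by norm_num) (by linarith)
  refine ⟨?_, by linarith, by linarith⟩
  refine mem_E_of_opposite (σ := -1) ⟨by linarith, by linarith⟩ (hsub.trans ?_)
    hKd (Or.inr rfl) hξ 2 1 ?_ ?_
  · exact Ioo_subset_Ioo_right (le_min le_rfl (by linarith))
  · have h1 : T (1 / w) (1 / w - 1) = -(1 / (w - 1)) := by
      refine T_eq_of_inv (-1) (by linarith) ?_ (by linarith) (by linarith)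
      have : w - 1 ≠ 0 := by linarith
      have : 1 - w ≠ 0 := by linarith
      rw [show 1 / w - 1 = -((w - 1) / w) by field_simp; ring, one_div_neg_eq_neg_one_div,
        one_div_div]
      push_cast
      field_simp
      ring
    rw [Function.iterate_succ_apply, h1, Function.iterate_one, neg_one_mul]
    refine T_eq_of_inv (2 - D) (by linarith) ?_ (by linarith) (by linarith)
    rw [one_div_neg_eq_neg_one_div, one_div_one_div, hw]
    push_cast
    ring
  · rw [Function.iterate_one, neg_neg, one_mul]
    refine T_eq_of_inv (D - 1) hwi0.ne' ?_ (by linarith) hξs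
    rw [one_div_one_div, hw]
    push_cast
    ring

theorem dimH_E_near_one {δ : ℝ} (hδ : 0 < δ) : 1 / 2 < dimH (E ∩ Ioo (1 - δ) (1 + δ)) := by
  obtain ⟨D, K, hKdim, hK1, hD, hDδ, hKd, hKsub⟩ := exists_endpoint_family hδ
  refine (hKdim.trans_le (dimH_le_dimH_mobius_image (D - 2) (D - 1) 1 1
    (by ring) (by linarith) zero_le_one K hK1)).trans_le (dimH_mono ?_)
  rintro _ ⟨ξ, hξ, rfl⟩
  simp only [one_mul]
  have hξ0 := (hK1 hξ).1
  have hξs := (hKsub ξ hξ hξ).2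
  have hsub := hKsub ξ hξ
  set w : ℝ := D - 1 + ξ with hw
  have hw3 : 3 < w := by linarith
  have hwi : 1 / w < 1 / 3 := one_div_lt_one_div_of_lt (by norm_num) hw3
  have hwi0 : 0 < 1 / w := by positivity
  have hwD : 1 / w < 1 / ((D : ℝ) - 1) := one_div_lt_one_div_of_lt (by linarith) (by linarith)
  have hw1 : 0 < 1 / (w - 1) := one_div_pos.2 (by linarith)
  have hw2 : 1 / (w - 1) < 1 / 2 := one_div_lt_one_div_of_lt (by norm_num) (by linarith)
  have hα : (D - 2 + ξ) / w = 1 - 1 / w := by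
    rw [show (D : ℝ) - 2 + ξ = w - 1 by rw [hw]; ring]
    field_simp
  rw [hα]
  refine ⟨?_, by linarith, by linarith⟩
  refine mem_E_of_opposite (σ := -1) ⟨by linarith, by linarith⟩ (hsub.trans ?_)
    hKd (Or.inr rfl) hξ 1 2 ?_ ?_
  · exact Ioo_subset_Ioo_right (le_min (by linarith) (by linarith))
  · rw [Function.iterate_one, neg_one_mul, show 1 - 1 / w - 1 = -(1 / w) by ring]
    refine T_eq_of_inv (1 - D) (by linarith) ?_ (by linarith) (by linarith)
    rw [one_div_neg_eq_neg_one_div, one_div_one_div, hw]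
    push_cast
    ring
  · have h1 : T (1 - 1 / w) (1 - 1 / w) = 1 / (w - 1) := by
      refine T_eq_of_inv 1 (by linarith) ?_ (by linarith) (by linarith)
      have : w - 1 ≠ 0 := by linarith
      rw [show 1 - 1 / w = (w - 1) / w by field_simp, one_div_div]
      push_cast
      field_simp
      ring
    rw [Function.iterate_succ_apply, h1, Function.iterate_one, neg_neg, one_mul]
    refine T_eq_of_inv (D - 2) hw1.ne' ?_ (by linarith) (by linarith)
    rw [one_div_one_div, hw]
    push_cast
    ring

theorem stmt13 (r : ℝ) (hr : r ∈ E ∩ Set.range ((↑) : ℚ → ℝ)) (δ : ℝ) (hδ : 0 < δ) :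
    1 / 2 < dimH (E ∩ Set.Ioo (r - δ) (r + δ)) := by
  obtain ⟨hE, x, rfl⟩ := hr
  rcases hE.1.1.eq_or_lt with h0 | h0
  · rw [← h0]
    exact dimH_E_near_zero hδ
  rcases hE.1.2.eq_or_lt with h1 | h1
  · rw [h1]
    exact dimH_E_near_one hδ
  have hx : (x : ℝ) = ((x.num : ℤ) : ℝ) / ((x.den : ℤ) : ℝ) := by
    rw [Int.cast_natCast]
    exact Rat.cast_def x
  rw [hx] at hE ⊢
  refine dimH_E_near_of_mem_Ioo (Rat.num_pos.2 (by exact_mod_cast h0)) ?_ ?_ hE hδ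
  · exact Rat.num_lt_denom_iff.2 (by exact_mod_cast h1)
  · exact Int.isCoprime_iff_gcd_eq_one.2 x.reduced
end

section
/- For every n ≥ 1: dim_H(H_n) > 1/2, dim_H(C_n) < 1, and moreover lim_{n→∞} dim_H(C_n) = 1. -/
open Set Filter MeasureTheory
open scoped ENNReal

/-- The `(k+1)`-st regular continued fraction digit of `x`, i.e. `a_{k+1} = ⌊1/T₁^k(x)⌋`. -/
noncomputable def rcfDigit (x : ℝ) (k : ℕ) : ℤ := ⌊1 / (T 1)^[k] x⌋

/-- `H n`: numbers all of whose regular continued fraction digits are `≥ n`. -/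
noncomputable def Hset (n : ℕ) : Set ℝ :=
  {x ∈ Set.Icc 0 1 | ∀ k, (n : ℤ) ≤ rcfDigit x k}

/-- `C n`: numbers whose regular continued fraction expansion contains no `n`
consecutive digits all equal to `1`. -/
noncomputable def Cset (n : ℕ) : Set ℝ :=
  {x ∈ Set.Icc 0 1 | ∀ k, ∃ j < n, rcfDigit x (k + j) ≠ 1}


/-- The inverse branch of the Gauss map with digit `a`. -/
noncomputable def gaussBranch (a : ℕ) (y : ℝ) : ℝ := 1 / (a + y)

/-- For `t = q' / q`, where `q', q` are consecutive continuant denominators of a word `u`, this is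
the ratio of the lengths of the cylinders of `ua` and of `u`. -/
noncomputable def branchRatio (a : ℕ) (t : ℝ) : ℝ := (1 + t) / ((a + t) * (a + t + 1))

/-- `f` behaves on `[0, 1]` like a composition of inverse branches of the Gauss map whose image
has length `D` and whose last two continuant denominators have quotient `t`. -/
structure IsCylinderMap (f : ℝ → ℝ) (D t : ℝ) : Prop where
  length_pos : 0 < D
  nonneg : 0 ≤ t
  le_one : t ≤ 1
  abs_sub : ∀ y ∈ Icc (0 : ℝ) 1, ∀ z ∈ Icc (0 : ℝ) 1,
    |f y - f z| = D * (1 + t) * |y - z| / ((1 + t * y) * (1 + t * z))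

lemma isCylinderMap_id : IsCylinderMap id 1 0 :=
  ⟨one_pos, le_rfl, zero_le_one, fun y _ z _ => by simp⟩

lemma gaussBranch_mem_Icc {a : ℕ} (ha : 1 ≤ a) {y : ℝ} (hy : y ∈ Icc (0 : ℝ) 1) :
    gaussBranch a y ∈ Icc (0 : ℝ) 1 := by
  have ha' : (1 : ℝ) ≤ a := by exact_mod_cast ha
  have := hy.1
  refine ⟨by unfold gaussBranch; positivity, ?_⟩
  unfold gaussBranch
  rw [div_le_one (by linarith)]
  linarith

lemma branchRatio_pos {a : ℕ} (ha : 1 ≤ a) {t : ℝ} (ht : 0 ≤ t) : 0 < branchRatio a t := by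
  have ha' : (1 : ℝ) ≤ a := by exact_mod_cast ha
  unfold branchRatio
  positivity

lemma branchRatio_le_half {a : ℕ} (ha : 1 ≤ a) {t : ℝ} (ht : 0 ≤ t) :
    branchRatio a t ≤ 1 / 2 := by
  have ha' : (1 : ℝ) ≤ a := by exact_mod_cast ha
  unfold branchRatio
  rw [div_le_div_iff₀ (by positivity) (by norm_num)]
  nlinarith

lemma IsCylinderMap.comp_gaussBranch {f : ℝ → ℝ} {D t : ℝ} (h : IsCylinderMap f D t) {a : ℕ}
    (ha : 1 ≤ a) :
    IsCylinderMap (f ∘ gaussBranch a) (D * branchRatio a t) (1 / (a + t)) := by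
  have ha' : (1 : ℝ) ≤ a := by exact_mod_cast ha
  have ht := h.nonneg
  have hD := h.length_pos
  refine ⟨mul_pos hD (branchRatio_pos ha ht), by positivity, ?_, ?_⟩
  · rw [div_le_one (by linarith)]
    linarith
  · intro y hy z hz
    have hy0 := hy.1
    have hz0 := hz.1
    rw [Function.comp_apply, Function.comp_apply,
      h.abs_sub _ (gaussBranch_mem_Icc ha hy) _ (gaussBranch_mem_Icc ha hz)]
    have : gaussBranch a y - gaussBranch a z = (z - y) / ((a + y) * (a + z)) := by
      unfold gaussBranch
      field_simp
      ring
    rw [this, abs_div, abs_of_pos (show 0 < ((a : ℝ) + y) * (a + z) by positivity), abs_sub_comm]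
    unfold gaussBranch branchRatio
    field_simp
    ring

lemma IsCylinderMap.half_le {f : ℝ → ℝ} {D t : ℝ} (h : IsCylinderMap f D t) {y z : ℝ}
    (hy : y ∈ Icc (0 : ℝ) 1) (hz : z ∈ Icc (0 : ℝ) 1) : D / 2 * |y - z| ≤ |f y - f z| := by
  obtain ⟨hD, ht, ht1, hf⟩ := h
  rw [hf y hy z hz, le_div_iff₀ (by nlinarith [hy.1, hz.1, mul_nonneg ht hy.1, mul_nonneg ht hz.1])]
  have h1 : (1 + t * y) * (1 + t * z) ≤ 2 * (1 + t) := by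
    have h2 : 1 + t * y ≤ 1 + t := by nlinarith [hy.2]
    have h3 : 1 + t * z ≤ 2 := by nlinarith [hz.2, hz.1]
    calc (1 + t * y) * (1 + t * z) ≤ (1 + t) * 2 := by
          apply mul_le_mul h2 h3 _ (by linarith)
          nlinarith [mul_nonneg ht hz.1]
      _ = _ := by ring
  have h4 : 0 ≤ D * |y - z| := by positivity
  nlinarith

lemma IsCylinderMap.abs_sub_le {f : ℝ → ℝ} {D t : ℝ} (h : IsCylinderMap f D t) {y z : ℝ}
    (hy : y ∈ Icc (0 : ℝ) 1) (hz : z ∈ Icc (0 : ℝ) 1) : |f y - f z| ≤ D := by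
  obtain ⟨hD, ht, ht1, hf⟩ := h
  have h1 := mul_nonneg ht hy.1
  have h2 := mul_nonneg ht hz.1
  rw [hf y hy z hz, div_le_iff₀ (by positivity), mul_assoc]
  refine mul_le_mul_of_nonneg_left ?_ hD.le
  rcases abs_cases (y - z) with ⟨h3, h4⟩ | ⟨h3, h4⟩ <;> rw [h3] <;>
    nlinarith [hy.1, hz.1, hy.2, hz.2, mul_nonneg h1 h2]

/-- Points whose continued fraction digits follow the transition rule `nx` from the state `j`, the
digits allowed in each state being given by `A`, up to the digit number `k`. -/
def cylinderUnion {S : Type*} (N : ℕ) (A : S → Finset ℕ) (nx : S → ℕ → S) : ℕ → S → Set ℝ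
  | 0, _ => Icc (1 / (N + 1)) ((N + 1) / (N + 2))
  | k + 1, j => ⋃ a ∈ A j, gaussBranch a '' cylinderUnion N A nx k (nx j a)

/-- Points whose continued fraction digits follow the transition rule `nx` from the state `j`, the
digits allowed in each state being given by `A`. -/
def limitSet {S : Type*} (N : ℕ) (A : S → Finset ℕ) (nx : S → ℕ → S) (j : S) : Set ℝ :=
  ⋂ k, cylinderUnion N A nx k j

section LimitSet

variable {S : Type*} {N : ℕ} {A : S → Finset ℕ} {nx : S → ℕ → S}

lemma gaussBranch_mem_base {a : ℕ} (ha : a ∈ Finset.Icc 1 N) {y : ℝ}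
    (hy : y ∈ Icc (1 / (N + 1) : ℝ) ((N + 1) / (N + 2))) :
    gaussBranch a y ∈ Icc (1 / (N + 1) : ℝ) ((N + 1) / (N + 2)) := by
  rw [Finset.mem_Icc] at ha
  have ha1 : (1 : ℝ) ≤ a := by exact_mod_cast ha.1
  have ha2 : (a : ℝ) ≤ N := by exact_mod_cast ha.2
  have h0 : (0 : ℝ) ≤ N := Nat.cast_nonneg N
  have hy2 : y ≤ 1 := hy.2.trans (by rw [div_le_one (by positivity)]; linarith)
  have hy0 : 0 < y := lt_of_lt_of_le (by positivity) hy.1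
  unfold gaussBranch
  constructor
  · gcongr
  · calc 1 / (a + y) ≤ 1 / (1 + 1 / (N + 1)) := by
          gcongr
          exact hy.1
      _ = _ := by field_simp; ring

lemma base_subset_Ioo : Icc (1 / (N + 1) : ℝ) ((N + 1) / (N + 2)) ⊆ Ioo 0 1 := by
  have h0 : (0 : ℝ) ≤ N := Nat.cast_nonneg N
  refine fun y hy => ⟨lt_of_lt_of_le (by positivity) hy.1, lt_of_le_of_lt hy.2 ?_⟩
  rw [div_lt_one (by positivity)]
  linarith

lemma cylinderUnion_subset_base (hA : ∀ j, A j ⊆ Finset.Icc 1 N) (k : ℕ) (j : S) :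
    cylinderUnion N A nx k j ⊆ Icc (1 / (N + 1) : ℝ) ((N + 1) / (N + 2)) := by
  induction k generalizing j with
  | zero => exact subset_rfl
  | succ k ih =>
    simp only [cylinderUnion, iUnion_subset_iff, image_subset_iff]
    exact fun a ha y hy => gaussBranch_mem_base (hA j ha) (ih _ hy)

lemma cylinderUnion_succ_subset (hA : ∀ j, A j ⊆ Finset.Icc 1 N) (k : ℕ) (j : S) :
    cylinderUnion N A nx (k + 1) j ⊆ cylinderUnion N A nx k j := by
  induction k generalizing j with
  | zero => exact cylinderUnion_subset_base hA 1 j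
  | succ k ih =>
    rw [cylinderUnion, cylinderUnion]
    exact iUnion₂_mono fun a _ => image_mono (ih _)

lemma isCompact_cylinderUnion (hA : ∀ j, A j ⊆ Finset.Icc 1 N) (k : ℕ) (j : S) :
    IsCompact (cylinderUnion N A nx k j) := by
  induction k generalizing j with
  | zero => exact isCompact_Icc
  | succ k ih =>
    refine (A j).isCompact_biUnion fun a ha => (ih _).image_of_continuousOn ?_
    unfold gaussBranch
    refine ContinuousOn.div continuousOn_const (by fun_prop) fun y hy => ?_
    have := (base_subset_Ioo (cylinderUnion_subset_base hA _ _ hy)).1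
    positivity

lemma isCompact_limitSet (hA : ∀ j, A j ⊆ Finset.Icc 1 N) (j : S) :
    IsCompact (limitSet N A nx j) :=
  (isCompact_cylinderUnion hA 0 j).of_isClosed_subset
    (isClosed_iInter fun k => (isCompact_cylinderUnion hA k j).isClosed) (iInter_subset _ 0)

lemma limitSet_nonempty (hA : ∀ j, A j ⊆ Finset.Icc 1 N) (hne : ∀ j, (A j).Nonempty) (j : S) :
    (limitSet N A nx j).Nonempty := by
  have hN : (1 : ℝ) ≤ N := by
    obtain ⟨a, ha⟩ := hne j
    have := Finset.mem_Icc.1 (hA j ha)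
    exact_mod_cast this.1.trans this.2
  refine IsCompact.nonempty_iInter_of_sequence_nonempty_isCompact_isClosed _
    (fun k => cylinderUnion_succ_subset hA k j) (fun k => ?_) (isCompact_cylinderUnion hA 0 j)
    fun k => (isCompact_cylinderUnion hA k j).isClosed
  induction k generalizing j with
  | zero =>
    refine nonempty_Icc.2 ?_
    rw [div_le_div_iff₀ (by positivity) (by positivity)]
    nlinarith
  | succ k ih =>
    obtain ⟨a, ha⟩ := hne j
    obtain ⟨y, hy⟩ := ih (nx j a)
    exact ⟨_, mem_iUnion₂.2 ⟨a, ha, mem_image_of_mem _ hy⟩⟩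

lemma limitSet_subset_base (hA : ∀ j, A j ⊆ Finset.Icc 1 N) (j : S) :
    limitSet N A nx j ⊆ Icc (1 / (N + 1) : ℝ) ((N + 1) / (N + 2)) :=
  (iInter_subset _ 0).trans (cylinderUnion_subset_base hA 0 j)

lemma gaussBranch_mem_limitSet (hA : ∀ j, A j ⊆ Finset.Icc 1 N) {j : S} {a : ℕ} (ha : a ∈ A j)
    {y : ℝ} (hy : y ∈ limitSet N A nx (nx j a)) : gaussBranch a y ∈ limitSet N A nx j := by
  have hy := mem_iInter.1 hy
  have h (k : ℕ) : gaussBranch a y ∈ cylinderUnion N A nx (k + 1) j :=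
    mem_iUnion₂.2 ⟨a, ha, mem_image_of_mem _ (hy k)⟩
  exact mem_iInter.2 fun k => cylinderUnion_succ_subset hA k j (h k)

lemma gaussBranch_gap {a b : ℕ} (ha : a ∈ Finset.Icc 1 N) (hb : b ∈ Finset.Icc 1 N) (hab : a ≠ b)
    {y z : ℝ} (hy : y ∈ Icc (1 / (N + 1) : ℝ) ((N + 1) / (N + 2)))
    (hz : z ∈ Icc (1 / (N + 1) : ℝ) ((N + 1) / (N + 2))) :
    1 / ((N : ℝ) + 1) ^ 3 ≤ |gaussBranch a y - gaussBranch b z| := by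
  wlog h : a < b generalizing a b y z
  · rw [abs_sub_comm]
    exact this hb ha hab.symm hz hy (by omega)
  rw [Finset.mem_Icc] at ha hb
  have h0 : (0 : ℝ) ≤ N := Nat.cast_nonneg N
  have ha1 : (1 : ℝ) ≤ a := by exact_mod_cast ha.1
  have ha2 : (a : ℝ) ≤ N := by exact_mod_cast ha.2
  have hb1 : (1 : ℝ) ≤ b := by exact_mod_cast hb.1
  have hb2 : (b : ℝ) ≤ N := by exact_mod_cast hb.2
  have hab' : (a : ℝ) + 1 ≤ b := by exact_mod_cast h
  obtain ⟨hy0, hy1⟩ := base_subset_Ioo hy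
  obtain ⟨hz0, hz1⟩ := base_subset_Ioo hz
  refine le_trans ?_ (le_abs_self _)
  have h1 : gaussBranch a y - gaussBranch b z = (b + z - a - y) / ((a + y) * (b + z)) := by
    unfold gaussBranch
    field_simp
    ring
  have h2 : 1 / ((N : ℝ) + 1) ≤ b + z - a - y := by
    have := hz.1
    linarith
  rw [h1]
  calc 1 / ((N : ℝ) + 1) ^ 3 = 1 / ((N : ℝ) + 1) / ((N + 1) * (N + 1)) := by field_simp
    _ ≤ _ := by
      gcongr
      exact le_trans (by positivity) h2

end LimitSet

section LowerBound

variable {S : Type*} {N : ℕ} {A : S → Finset ℕ} {nx : S → ℕ → S}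

open Classical in
lemma limitSet_cover_sum_ge (hA : ∀ j, A j ⊆ Finset.Icc 1 N) {G : S → ℝ} (hG0 : ∀ j, 0 < G j)
    (hG1 : ∀ j, G j ≤ 1) {s : ℝ} (hs : 0 < s)
    (hG : ∀ j, ∀ t ∈ Icc (0 : ℝ) 1, G j ≤ ∑ a ∈ A j, G (nx j a) * branchRatio a t ^ s)
    {ι : Type*} (I : Finset ι) (U : ι → Set ℝ) (d : ι → ℝ) (hd0 : ∀ i, 0 < d i)
    (hd : ∀ i, ∀ x ∈ U i, ∀ y ∈ U i, |x - y| ≤ d i) (k : ℕ) (f : ℝ → ℝ) (D t : ℝ) (j : S)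
    (hf : IsCylinderMap f D t) (hcov : f '' limitSet N A nx j ⊆ ⋃ i ∈ I, U i)
    (hk : ∀ i ∈ I, D * (1 / (2 * ((N : ℝ) + 1) ^ 3)) < 2 ^ k * d i) :
    (1 / (2 * ((N : ℝ) + 1) ^ 3)) ^ s * (G j * D ^ s) ≤
      ∑ i ∈ I with (U i ∩ f '' limitSet N A nx j).Nonempty, d i ^ s := by
  set c : ℝ := 1 / (2 * ((N : ℝ) + 1) ^ 3) with hc
  have hc0 : 0 < c := by positivity
  have hne (j : S) : (A j).Nonempty := by
    rw [Finset.nonempty_iff_ne_empty]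
    intro h
    have := (hG0 j).trans_le (hG j 0 (by simp))
    simp [h] at this
  have hmem {j : S} {y : ℝ} (hy : y ∈ limitSet N A nx j) : y ∈ Icc (0 : ℝ) 1 :=
    Ioo_subset_Icc_self (base_subset_Ioo (limitSet_subset_base hA j hy))
  induction k generalizing f D t j with
  | zero =>
    obtain ⟨x, hx⟩ := limitSet_nonempty hA hne j (nx := nx)
    obtain ⟨i, hi, hxi⟩ := mem_iUnion₂.1 (hcov (mem_image_of_mem f hx))
    have hD := hf.length_pos
    calc c ^ s * (G j * D ^ s) ≤ c ^ s * (1 * D ^ s) := by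
          gcongr
          exact hG1 j
      _ = (D * c) ^ s := by rw [Real.mul_rpow hD.le hc0.le]; ring
      _ ≤ d i ^ s := by
          gcongr
          simpa using (hk i hi).le
      _ ≤ _ := Finset.single_le_sum (f := fun i => d i ^ s)
          (fun i _ => Real.rpow_nonneg (hd0 i).le _)
          (Finset.mem_filter.2 ⟨hi, f x, hxi, mem_image_of_mem f hx⟩)
  | succ k ih =>
    have hD := hf.length_pos
    by_cases hbig : ∃ i ∈ I, (U i ∩ f '' limitSet N A nx j).Nonempty ∧ D * c ≤ d i
    · obtain ⟨i, hi, hiU, hDi⟩ := hbig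
      calc c ^ s * (G j * D ^ s) ≤ c ^ s * (1 * D ^ s) := by
            gcongr
            exact hG1 j
        _ = (D * c) ^ s := by rw [Real.mul_rpow hD.le hc0.le]; ring
        _ ≤ d i ^ s := by gcongr
        _ ≤ _ := Finset.single_le_sum (f := fun i => d i ^ s)
            (fun i _ => Real.rpow_nonneg (hd0 i).le _) (Finset.mem_filter.2 ⟨hi, hiU⟩)
    push Not at hbig
    have hsub {a : ℕ} (ha : a ∈ A j) : (f ∘ gaussBranch a) '' limitSet N A nx (nx j a) ⊆
        f '' limitSet N A nx j := by
      rw [image_comp]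
      exact image_mono (image_subset_iff.2 fun y hy => gaussBranch_mem_limitSet hA ha hy)
    have hA1 {a : ℕ} (ha : a ∈ A j) : 1 ≤ a := (Finset.mem_Icc.1 (hA j ha)).1
    have hchild (a : ℕ) (ha : a ∈ A j) : c ^ s * (G (nx j a) * (D * branchRatio a t) ^ s) ≤
        ∑ i ∈ I with (U i ∩ (f ∘ gaussBranch a) '' limitSet N A nx (nx j a)).Nonempty,
          d i ^ s := by
      refine ih _ _ _ _ (hf.comp_gaussBranch (hA1 ha)) ((hsub ha).trans hcov) fun i hi => ?_
      have h1 := hk i hi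
      have h2 := branchRatio_le_half (hA1 ha) hf.nonneg
      have h3 : D * branchRatio a t * c ≤ D * (1 / 2) * c := by gcongr
      rw [pow_succ] at h1
      linarith
    calc c ^ s * (G j * D ^ s)
        ≤ c ^ s * ((∑ a ∈ A j, G (nx j a) * branchRatio a t ^ s) * D ^ s) := by
          gcongr
          exact hG j t ⟨hf.nonneg, hf.le_one⟩
      _ = ∑ a ∈ A j, c ^ s * (G (nx j a) * (D * branchRatio a t) ^ s) := by
          rw [Finset.sum_mul, Finset.mul_sum]
          refine Finset.sum_congr rfl fun a ha => ?_
          rw [Real.mul_rpow hD.le (branchRatio_pos (hA1 ha) hf.nonneg).le]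
          ring
      _ ≤ ∑ a ∈ A j, ∑ i ∈ I with
            (U i ∩ (f ∘ gaussBranch a) '' limitSet N A nx (nx j a)).Nonempty, d i ^ s :=
          Finset.sum_le_sum hchild
      _ = ∑ i ∈ (A j).biUnion fun a => I.filter fun i =>
            (U i ∩ (f ∘ gaussBranch a) '' limitSet N A nx (nx j a)).Nonempty, d i ^ s := by
          refine (Finset.sum_biUnion fun a ha b hb hab => ?_).symm
          refine Finset.disjoint_left.2 fun i hia hib => ?_
          rw [Finset.mem_filter] at hia hib
          obtain ⟨hi, _, hyU, y, hy, rfl⟩ := hia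
          obtain ⟨-, _, hzU, z, hz, rfl⟩ := hib
          have h1 := hbig i hi ⟨_, hyU, hsub ha (mem_image_of_mem _ hy)⟩
          have h2 := hd i _ hyU _ hzU
          have h3 := hf.half_le (gaussBranch_mem_Icc (hA1 ha) (hmem hy))
            (gaussBranch_mem_Icc (hA1 hb) (hmem hz))
          have h4 := gaussBranch_gap (hA j ha) (hA j hb) hab (limitSet_subset_base hA _ hy)
            (limitSet_subset_base hA _ hz)
          have h5 : D * c = D / 2 * (1 / ((N : ℝ) + 1) ^ 3) := by
            rw [hc]
            field_simp
          have h6 : D / 2 * (1 / ((N : ℝ) + 1) ^ 3) ≤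
              D / 2 * |gaussBranch a y - gaussBranch b z| := by gcongr
          simp only [Function.comp_apply] at h2
          linarith
      _ ≤ _ := by
          refine Finset.sum_le_sum_of_subset_of_nonneg (fun i hi => ?_)
            fun i _ _ => Real.rpow_nonneg (hd0 i).le _
          simp only [Finset.mem_biUnion, Finset.mem_filter] at hi ⊢
          obtain ⟨a, ha, hi, hne⟩ := hi
          exact ⟨hi, hne.mono (inter_subset_inter_right _ (hsub ha))⟩

/-- A set of real numbers of zero Hausdorff measure has open covers whose `s`-dimensional size is
arbitrarily small. -/
lemma exists_open_cover_of_hausdorffMeasure_eq_zero {E : Set ℝ} {s : ℝ} (hs : 0 < s)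
    (h : μH[s] E = 0) {ε : ℝ} (hε : 0 < ε) :
    ∃ (U : ℕ → Set ℝ) (d : ℕ → ℝ), (∀ i, IsOpen (U i)) ∧ E ⊆ ⋃ i, U i ∧ (∀ i, 0 < d i) ∧
      (∀ i, ∀ x ∈ U i, ∀ y ∈ U i, |x - y| ≤ d i) ∧
      ∀ I : Finset ℕ, ∑ i ∈ I, d i ^ s < ε := by
  rw [Measure.hausdorffMeasure_apply] at h
  have h1 := ENNReal.iSup_eq_zero.1 h 1
  simp only [zero_lt_one, iSup_pos] at h1
  have h2 : (0 : ℝ≥0∞) < ENNReal.ofReal (ε / 2) := by simpa using hε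
  rw [← h1] at h2
  simp only [iInf_lt_iff] at h2
  obtain ⟨t, htE, htd, hsum⟩ := h2
  have hbd (i : ℕ) : Bornology.IsBounded (t i) :=
    Metric.isBounded_iff_ediam_ne_top.2 ((htd i).trans_lt ENNReal.one_lt_top).ne
  have hsum' (I : Finset ℕ) : ∑ i ∈ I, Metric.diam (t i) ^ s < ε / 2 := by
    have h3 : ∑ i ∈ I, ENNReal.ofReal (Metric.diam (t i) ^ s) < ENNReal.ofReal (ε / 2) := by
      refine lt_of_le_of_lt ((Finset.sum_le_sum fun i _ => ?_).trans
        (ENNReal.sum_le_tsum I)) hsum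
      rcases (t i).eq_empty_or_nonempty with h0 | h0
      · simp [h0, Real.zero_rpow hs.ne']
      · simp only [h0, iSup_pos]
        rw [← ENNReal.ofReal_rpow_of_nonneg Metric.diam_nonneg hs.le, Metric.diam,
          ENNReal.ofReal_toReal ((htd i).trans_lt ENNReal.one_lt_top).ne]
    rw [← ENNReal.ofReal_sum_of_nonneg
      fun i _ => Real.rpow_nonneg Metric.diam_nonneg _] at h3
    exact (ENNReal.ofReal_lt_ofReal_iff (by positivity)).1 h3
  obtain ⟨η, hη0, C, hη, hC⟩ := posSumOfEncodable (half_pos hε) ℕ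
  let d (i : ℕ) : ℝ := (Metric.diam (t i) ^ s + η i) ^ s⁻¹
  have hpos (i : ℕ) : 0 < Metric.diam (t i) ^ s + η i :=
    add_pos_of_nonneg_of_pos (Real.rpow_nonneg Metric.diam_nonneg _) (hη0 i)
  have hd0 (i : ℕ) : 0 < d i := Real.rpow_pos_of_pos (hpos i) _
  have hds (i : ℕ) : d i ^ s = Metric.diam (t i) ^ s + η i :=
    Real.rpow_inv_rpow (hpos i).le hs.ne'
  have hlt (i : ℕ) : Metric.diam (t i) < d i := by
    refine (Real.rpow_lt_rpow_iff Metric.diam_nonneg (hd0 i).le hs).1 ?_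
    rw [hds]
    linarith [hη0 i]
  refine ⟨fun i => Metric.thickening ((d i - Metric.diam (t i)) / 2) (t i), d,
    fun i => Metric.isOpen_thickening, htE.trans (iUnion_mono fun i =>
      Metric.self_subset_thickening (half_pos (sub_pos.2 (hlt i))) _), hd0, ?_, fun I => ?_⟩
  · intro i x hx y hy
    obtain ⟨x', hx', hxx⟩ := Metric.mem_thickening_iff.1 hx
    obtain ⟨y', hy', hyy⟩ := Metric.mem_thickening_iff.1 hy
    have h3 := Metric.dist_le_diam_of_mem (hbd i) hx' hy'
    rw [← Real.dist_eq]
    rw [dist_comm] at hyy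
    linarith [dist_triangle4 x x' y' y]
  · simp only [hds, Finset.sum_add_distrib]
    have h4 : ∑ i ∈ I, η i ≤ C := sum_le_hasSum I (fun i _ => (hη0 i).le) hη
    linarith [hsum' I]

/-- A lower bound for the dimension of a set of continued fractions described by a finite
transition rule, by means of a subinvariant weight `G`. -/
theorem le_dimH_limitSet (hA : ∀ j, A j ⊆ Finset.Icc 1 N) {G : S → ℝ} (hG0 : ∀ j, 0 < G j)
    (hG1 : ∀ j, G j ≤ 1) {s : ℝ} (hs : 0 < s)
    (hG : ∀ j, ∀ t ∈ Icc (0 : ℝ) 1, G j ≤ ∑ a ∈ A j, G (nx j a) * branchRatio a t ^ s) (j : S) :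
    ENNReal.ofReal s ≤ dimH (limitSet N A nx j) := by
  classical
  refine le_dimH_of_hausdorffMeasure_ne_zero (d := s.toNNReal) fun h => ?_
  rw [Real.coe_toNNReal s hs.le] at h
  have hε : 0 < (1 / (2 * ((N : ℝ) + 1) ^ 3)) ^ s * (G j * 1 ^ s) :=
    mul_pos (by positivity) (mul_pos (hG0 j) (by simp))
  obtain ⟨U, d, hUo, hcov, hd0, hd, hsum⟩ := exists_open_cover_of_hausdorffMeasure_eq_zero hs h hε
  obtain ⟨I, hI⟩ := (isCompact_limitSet hA j).elim_finite_subcover U hUo hcov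
  have hk : ∃ k : ℕ, ∀ i ∈ I, (1 : ℝ) * (1 / (2 * ((N : ℝ) + 1) ^ 3)) < 2 ^ k * d i := by
    have h1 : ∀ᶠ k : ℕ in atTop, ∀ i ∈ I,
        (1 : ℝ) * (1 / (2 * ((N : ℝ) + 1) ^ 3)) < 2 ^ k * d i :=
      (Filter.eventually_all_finset I).2 fun i _ =>
        ((tendsto_pow_atTop_atTop_of_one_lt one_lt_two).atTop_mul_const (hd0 i)).eventually_gt_atTop _
    exact h1.exists
  obtain ⟨k, hk⟩ := hk
  refine (hsum (I.filter fun i => (U i ∩ id '' limitSet N A nx j).Nonempty)).not_ge ?_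
  exact limitSet_cover_sum_ge hA hG0 hG1 hs hG I U d hd0 hd k id 1 0 j isCylinderMap_id
    (by simpa using hI) hk

end LowerBound

lemma T_one (x : ℝ) : T 1 x = Int.fract (1 / x) := by
  unfold T
  split_ifs with h
  · simp [h]
  · rw [add_sub_cancel_right]
    rfl

lemma rcfDigit_zero (x : ℝ) : rcfDigit x 0 = ⌊1 / x⌋ := rfl

lemma rcfDigit_add_one (x : ℝ) (k : ℕ) : rcfDigit x (k + 1) = rcfDigit (T 1 x) k := rfl

lemma rcfDigit_add (x : ℝ) (k j : ℕ) : rcfDigit x (k + j) = rcfDigit ((T 1)^[k] x) j := by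
  unfold rcfDigit
  rw [add_comm, Function.iterate_add_apply]

lemma gaussBranch_floor {a : ℕ} {y : ℝ} (hy : y ∈ Ioo (0 : ℝ) 1) :
    ⌊1 / gaussBranch a y⌋ = a ∧ T 1 (gaussBranch a y) = y := by
  have h : 1 / gaussBranch a y = (a : ℤ) + y := by simp [gaussBranch]
  have hy' : Int.fract y = y := Int.fract_eq_self.2 ⟨hy.1.le, hy.2⟩
  rw [T_one, h, Int.floor_intCast_add, Int.fract_intCast_add, hy', Int.floor_eq_zero_iff.2
    ⟨hy.1.le, hy.2⟩]
  simp

section LimitSetDigits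

variable {S : Type*} {N : ℕ} {A : S → Finset ℕ} {nx : S → ℕ → S}

lemma limitSet_step (hA : ∀ j, A j ⊆ Finset.Icc 1 N) {j : S} {x : ℝ}
    (hx : x ∈ limitSet N A nx j) :
    ∃ a ∈ A j, rcfDigit x 0 = a ∧ T 1 x ∈ limitSet N A nx (nx j a) := by
  have hx := mem_iInter.1 hx
  have key (k : ℕ) : ∃ a ∈ A j, rcfDigit x 0 = a ∧ T 1 x ∈ cylinderUnion N A nx k (nx j a) := by
    obtain ⟨a, ha, y, hy, rfl⟩ := mem_iUnion₂.1 (hx (k + 1))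
    obtain ⟨h1, h2⟩ := gaussBranch_floor (a := a)
      (base_subset_Ioo (cylinderUnion_subset_base hA _ _ hy))
    exact ⟨a, ha, h1, h2.symm ▸ hy⟩
  obtain ⟨a, ha, hxa, -⟩ := key 0
  refine ⟨a, ha, hxa, mem_iInter.2 fun k => ?_⟩
  obtain ⟨b, -, hxb, hb⟩ := key k
  obtain rfl : b = a := by exact_mod_cast hxb.symm.trans hxa
  exact hb

lemma iterate_mem_limitSet (hA : ∀ j, A j ⊆ Finset.Icc 1 N) {p : S → Prop}
    (hp : ∀ j, p j → ∀ a ∈ A j, p (nx j a)) {j : S} (hj : p j) {x : ℝ}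
    (hx : x ∈ limitSet N A nx j) (k : ℕ) : ∃ i, p i ∧ (T 1)^[k] x ∈ limitSet N A nx i := by
  induction k with
  | zero => exact ⟨j, hj, hx⟩
  | succ k ih =>
    obtain ⟨i, hi, h⟩ := ih
    obtain ⟨a, ha, -, h'⟩ := limitSet_step hA h
    rw [Function.iterate_succ_apply']
    exact ⟨_, hp i hi a ha, h'⟩

lemma limitSet_subset_Icc (hA : ∀ j, A j ⊆ Finset.Icc 1 N) (j : S) :
    limitSet N A nx j ⊆ Icc 0 1 :=
  (limitSet_subset_base hA j).trans (base_subset_Ioo.trans Ioo_subset_Icc_self)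

end LimitSetDigits

theorem half_lt_dimH_Hset {n : ℕ} (hn : 1 ≤ n) : 1 / 2 < dimH (Hset n) := by
  have hdiv : Tendsto (fun M => ∑ a ∈ Finset.range M, 1 / ((a : ℝ) + 2)) atTop atTop := by
    refine (not_summable_iff_tendsto_nat_atTop_of_nonneg fun a => by positivity).1 fun h => ?_
    refine Real.not_summable_one_div_natCast ((summable_nat_add_iff 2).1 ?_)
    simpa using h
  obtain ⟨M, hM⟩ := (hdiv.eventually_gt_atTop
    (1 + ∑ a ∈ Finset.range n, 1 / ((a : ℝ) + 2))).and (eventually_ge_atTop n) |>.exists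
  have hsum : 1 < ∑ a ∈ Finset.Ico n M, (1 / ((a : ℝ) + 2) ^ 2) ^ (1 / 2 : ℝ) := by
    have h1 (a : ℕ) : (1 / ((a : ℝ) + 2) ^ 2) ^ (1 / 2 : ℝ) = 1 / ((a : ℝ) + 2) := by
      rw [← Real.sqrt_eq_rpow, ← one_div_pow, Real.sqrt_sq (by positivity)]
    simp only [h1]
    rw [Finset.sum_Ico_eq_sub _ hM.2]
    linarith [hM.1]
  have hcont : Continuous fun s : ℝ => ∑ a ∈ Finset.Ico n M, (1 / ((a : ℝ) + 2) ^ 2) ^ s :=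
    continuous_finsetSum _ fun a _ => Real.continuous_const_rpow (by positivity)
  obtain ⟨s, hs1, hs⟩ : ∃ s : ℝ, 1 < ∑ a ∈ Finset.Ico n M, (1 / ((a : ℝ) + 2) ^ 2) ^ s ∧
      1 / 2 < s := by
    have h1 := (hcont.tendsto (1 / 2)).eventually_const_lt hsum
    exact ((h1.filter_mono nhdsWithin_le_nhds).and
      (self_mem_nhdsWithin (s := Ioi (1 / 2 : ℝ)))).exists
  have hA : ∀ _ : Unit, Finset.Ico n M ⊆ Finset.Icc 1 M := fun _ a ha => by
    rw [Finset.mem_Ico] at ha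
    exact Finset.mem_Icc.2 ⟨hn.trans ha.1, ha.2.le⟩
  have hle := le_dimH_limitSet (nx := fun _ _ => ()) hA (G := fun _ => 1) (fun _ => one_pos)
    (fun _ => le_rfl) (by linarith : 0 < s) (fun _ t ht => ?_) ()
  · have hsub : limitSet M (fun _ => Finset.Ico n M) (fun _ _ => ()) () ⊆ Hset n := by
      refine fun x hx => ⟨limitSet_subset_Icc hA _ hx, fun k => ?_⟩
      obtain ⟨i, -, hi⟩ := iterate_mem_limitSet hA (p := fun _ => True) (fun _ _ _ _ => trivial)
        trivial hx k
      obtain ⟨a, ha, h, -⟩ := limitSet_step hA hi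
      rw [← add_zero k, rcfDigit_add, h]
      exact_mod_cast (Finset.mem_Ico.1 ha).1
    refine lt_of_lt_of_le ?_ (hle.trans (dimH_mono hsub))
    rw [← ENNReal.ofReal_lt_ofReal_iff (by linarith), ENNReal.ofReal_div_of_pos two_pos] at hs
    simpa using hs
  · refine hs1.le.trans (Finset.sum_le_sum fun a ha => ?_)
    rw [one_mul]
    have ha1 : (1 : ℝ) ≤ a := by exact_mod_cast hn.trans (Finset.mem_Ico.1 ha).1
    have := ht.1
    unfold branchRatio
    refine Real.rpow_le_rpow (by positivity) ?_ (by linarith)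
    rw [div_le_div_iff₀ (by positivity) (by positivity)]
    nlinarith [ht.2]

lemma sum_branchRatio (N : ℕ) {t : ℝ} (ht : 0 ≤ t) :
    ∑ b ∈ Finset.range N, branchRatio (b + 1) t = 1 - (1 + t) / (N + 1 + t) := by
  induction N with
  | zero =>
    have : (1 + t) ≠ 0 := by positivity
    simp [this]
  | succ N ih =>
    rw [Finset.sum_range_succ, ih, branchRatio]
    push_cast
    field_simp
    ring

lemma rpow_branchRatio_ge {a : ℕ} (ha : 1 ≤ a) {t : ℝ} (ht : 0 ≤ t) {s : ℝ} (hs : s ≤ 1) :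
    2 ^ (1 - s) * branchRatio a t ≤ branchRatio a t ^ s := by
  have hc := branchRatio_pos ha ht
  have h2 := branchRatio_le_half ha ht
  have h1 : branchRatio a t ^ s = branchRatio a t ^ (s - 1) * branchRatio a t := by
    rw [← Real.rpow_add_one hc.ne']
    simp
  have h3 : (2 : ℝ) ^ (1 - s) = (1 / 2) ^ (s - 1) := by
    rw [one_div, Real.inv_rpow zero_le_two, ← Real.rpow_neg zero_le_two, neg_sub]
  rw [h1, h3]
  exact mul_le_mul_of_nonneg_right (Real.rpow_le_rpow_of_nonpos hc h2 (by linarith)) hc.le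

lemma limitSet_subset_Cset {N n : ℕ} {A : ℕ → Finset ℕ} (hA : ∀ r, A r ⊆ Finset.Icc 1 N)
    (hA0 : 1 ∉ A 0) (hn : 1 ≤ n) :
    limitSet N A (fun r a => if a = 1 then r - 1 else n - 1) (n - 1) ⊆ Cset n := by
  have hrun (r : ℕ) : ∀ x ∈ limitSet N A (fun r a => if a = 1 then r - 1 else n - 1) r,
      ∃ j < r + 1, rcfDigit x j ≠ 1 := by
    induction r with
    | zero =>
      intro x hx
      obtain ⟨a, ha, h, -⟩ := limitSet_step hA hx
      refine ⟨0, one_pos, fun h1 => hA0 ?_⟩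
      obtain rfl : a = 1 := by exact_mod_cast h.symm.trans h1
      exact ha
    | succ r ih =>
      intro x hx
      obtain ⟨a, ha, h, hT⟩ := limitSet_step hA hx
      by_cases h1 : a = 1
      · simp only [h1, if_true, Nat.add_sub_cancel] at hT
        obtain ⟨j, hj, hj1⟩ := ih _ hT
        exact ⟨j + 1, by omega, hj1⟩
      · refine ⟨0, by omega, fun h2 => h1 ?_⟩
        exact_mod_cast h.symm.trans h2
  refine fun x hx => ⟨limitSet_subset_Icc hA _ hx, fun k => ?_⟩
  obtain ⟨r, hr, hk⟩ := iterate_mem_limitSet hA (p := fun r => r ≤ n - 1)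
    (fun r hr a _ => by split_ifs <;> omega) le_rfl hx k
  obtain ⟨j, hj, h⟩ := hrun r _ hk
  exact ⟨j, by omega, by rwa [rcfDigit_add]⟩

theorem eventually_le_dimH_Cset {s : ℝ} (hs0 : 0 < s) (hs1 : s < 1) :
    ∀ᶠ n : ℕ in atTop, ENNReal.ofReal s ≤ dimH (Cset n) := by
  set β : ℝ := 2 ^ (1 - s) with hβ
  have hβ1 : 1 < β := Real.one_lt_rpow one_lt_two (by linarith)
  set κ : ℝ := (1 / 2) ^ s with hκ
  have hκ0 : 0 < κ := by positivity
  have hκ1 : κ < 1 := Real.rpow_lt_one (by norm_num) (by norm_num) hs0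
  obtain ⟨N, hN⟩ : ∃ N : ℕ, 2 * β / ((β - 1) / 2) ≤ N := exists_nat_ge _
  have hsum {t : ℝ} (ht : t ∈ Icc (0 : ℝ) 1) :
      1 + (β - 1) / 2 ≤ ∑ b ∈ Finset.range (N + 1), branchRatio (b + 1) t ^ s := by
    have h1 : β * ∑ b ∈ Finset.range (N + 1), branchRatio (b + 1) t ≤
        ∑ b ∈ Finset.range (N + 1), branchRatio (b + 1) t ^ s := by
      rw [Finset.mul_sum]
      exact Finset.sum_le_sum fun b _ => rpow_branchRatio_ge (by omega) ht.1 hs1.le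
    refine le_trans ?_ h1
    rw [sum_branchRatio _ ht.1]
    push_cast
    have ht0 := ht.1
    have hN0 : (0 : ℝ) ≤ N := Nat.cast_nonneg N
    have h2 : β * ((1 + t) / (N + 1 + 1 + t)) ≤ (β - 1) / 2 := by
      rw [div_le_iff₀ (by linarith)] at hN
      rw [← mul_div_assoc, div_le_iff₀ (by positivity)]
      nlinarith [ht.2]
    linarith
  have hlim : Tendsto (fun n : ℕ => (1 + (β - 1) / 2) * (1 - κ ^ n)) atTop
      (nhds ((1 + (β - 1) / 2) * (1 - 0))) :=
    ((tendsto_pow_atTop_nhds_zero_of_lt_one hκ0.le hκ1).const_sub 1).const_mul _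
  filter_upwards [hlim.eventually_const_le (u := 1) (by linarith), eventually_ge_atTop 1]
    with n hn hn1
  have hA : ∀ r : ℕ, (if r = 0 then Finset.Icc 2 (N + 1) else Finset.Icc 1 (N + 1)) ⊆
      Finset.Icc 1 (N + 1) := fun r => by
    split_ifs
    · exact Finset.Icc_subset_Icc_left one_le_two
    · exact subset_rfl
  refine le_trans ?_ (dimH_mono (limitSet_subset_Cset hA (by simp) hn1))
  have hpow (m : ℕ) : κ ^ (m + 1) < 1 := pow_lt_one₀ hκ0.le hκ1 (Nat.succ_ne_zero m)
  refine le_dimH_limitSet hA (G := fun r => 1 - κ ^ (r + 1)) (fun r => sub_pos.2 (hpow r))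
    (fun r => by linarith [pow_pos hκ0 (r + 1)]) hs0 (fun r t ht => ?_) _
  have hsplit : ∑ b ∈ Finset.range (N + 1), branchRatio (b + 1) t ^ s =
      branchRatio 1 t ^ s + ∑ a ∈ Finset.Icc 2 (N + 1), branchRatio a t ^ s := by
    have : Finset.Ico 1 (N + 1 + 1) = insert 1 (Finset.Icc 2 (N + 1)) := by
      ext a
      simp only [Finset.mem_insert, Finset.mem_Icc, Finset.mem_Ico]
      omega
    rw [Finset.range_eq_Ico, Finset.sum_Ico_add' (fun a => branchRatio a t ^ s) 0 (N + 1) 1,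
      zero_add, this, Finset.sum_insert (by simp)]
  have hS := hsum ht
  rw [hsplit] at hS
  set P := ∑ a ∈ Finset.Icc 2 (N + 1), branchRatio a t ^ s
  have hx0 : 0 ≤ branchRatio 1 t ^ s := Real.rpow_nonneg (branchRatio_pos le_rfl ht.1).le _
  have hxκ : branchRatio 1 t ^ s ≤ κ :=
    Real.rpow_le_rpow (branchRatio_pos le_rfl ht.1).le (branchRatio_le_half le_rfl ht.1) hs0.le
  set x := branchRatio 1 t ^ s
  have htail : ∑ a ∈ Finset.Icc 2 (N + 1),
      (1 - κ ^ ((if a = 1 then r - 1 else n - 1) + 1)) * branchRatio a t ^ s =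
      (1 - κ ^ n) * P := by
    rw [Finset.mul_sum]
    refine Finset.sum_congr rfl fun a ha => ?_
    rw [if_neg (by have := (Finset.mem_Icc.1 ha).1; omega), Nat.sub_add_cancel hn1]
  have hg0 : 0 < κ ^ n := pow_pos hκ0 n
  have hg1 : κ ^ n < 1 := pow_lt_one₀ hκ0.le hκ1 (by omega)
  have hPg : 1 - x * (1 - κ ^ n) ≤ (1 - κ ^ n) * P := by nlinarith
  rcases Nat.eq_zero_or_pos r with rfl | hr
  · simp only [if_true]
    rw [htail]
    simp only [zero_add, pow_one]
    nlinarith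
  · simp only [hr.ne', if_false]
    have : Finset.Icc 1 (N + 1) = insert 1 (Finset.Icc 2 (N + 1)) := by
      ext a
      simp only [Finset.mem_insert, Finset.mem_Icc]
      omega
    rw [this, Finset.sum_insert (by simp), htail]
    simp only [if_true, Nat.sub_add_cancel hr]
    have hr0 : 0 < κ ^ r := pow_pos hκ0 r
    rw [pow_succ]
    nlinarith [mul_nonneg hx0 hg0.le, mul_le_mul_of_nonneg_right hxκ hr0.le]

lemma hasSum_branchRatio {t : ℝ} (ht : 0 ≤ t) : HasSum (fun b : ℕ => branchRatio (b + 1) t) 1 := by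
  rw [hasSum_iff_tendsto_nat_of_nonneg fun b => (branchRatio_pos (by omega) ht).le]
  simp only [sum_branchRatio _ ht]
  have h1 : Tendsto (fun N : ℕ => (N : ℝ) + 1 + t) atTop atTop := by
    simp only [add_assoc]
    exact tendsto_atTop_add_const_right _ _ tendsto_natCast_atTop_atTop
  simpa using (h1.const_div_atTop (1 + t)).const_sub 1

lemma rpow_branchRatio_le (b : ℕ) {t : ℝ} (ht : t ∈ Icc (0 : ℝ) 1) {u : ℝ} (hu0 : 0 ≤ u)
    (hu : u ≤ 1 / 4) :
    branchRatio (b + 1) t ^ (1 - u) ≤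
      branchRatio (b + 1) t + 4 * u * (2 / ((b : ℝ) + 1) ^ 2) ^ (3 / 4 : ℝ) := by
  have hc := branchRatio_pos (a := b + 1) (by omega) ht.1
  have hle : branchRatio (b + 1) t ≤ 2 / ((b : ℝ) + 1) ^ 2 := by
    have := ht.1
    unfold branchRatio
    push_cast
    rw [div_le_div_iff₀ (by positivity) (by positivity)]
    have h1 : ((b : ℝ) + 1) ^ 2 ≤ (b + 1 + t) * (b + 1 + t + 1) := by nlinarith
    have h2 : 0 ≤ ((b : ℝ) + 1) ^ 2 := by positivity
    nlinarith [ht.2]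
  set c := branchRatio (b + 1) t
  have hpos : 0 < c ^ (-(1 / 4) : ℝ) := Real.rpow_pos_of_pos hc _
  have hB := rpow_one_add_le_one_add_mul_self (s := c ^ (-(1 / 4) : ℝ) - 1) (by linarith)
    (p := 4 * u) (by linarith) (by linarith)
  rw [add_sub_cancel, ← Real.rpow_mul hc.le] at hB
  have h1 : c ^ (1 - u) = c * c ^ (-(1 / 4) * (4 * u)) := by
    rw [← Real.rpow_one_add' hc.le (by linarith)]
    congr 1
    ring
  have h2 : c * c ^ (-(1 / 4) : ℝ) = c ^ (3 / 4 : ℝ) := by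
    rw [← Real.rpow_one_add' hc.le (by norm_num)]
    norm_num
  calc c ^ (1 - u) ≤ c * (1 + 4 * u * (c ^ (-(1 / 4) : ℝ) - 1)) := by rw [h1]; gcongr
    _ ≤ c + 4 * u * (c * c ^ (-(1 / 4) : ℝ)) := by nlinarith [mul_nonneg hu0 hc.le]
    _ ≤ _ := by
      rw [h2]
      gcongr

lemma summable_rpow_bound :
    Summable fun b : ℕ => (2 / ((b : ℝ) + 1) ^ 2) ^ (3 / 4 : ℝ) := by
  have h := ((Real.summable_one_div_nat_add_rpow 1 (3 / 2)).2 (by norm_num)).mul_left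
    ((2 : ℝ) ^ (3 / 4 : ℝ))
  refine h.congr fun b => ?_
  rw [abs_of_pos (by positivity), Real.div_rpow zero_le_two (by positivity), ← Real.rpow_natCast,
    ← Real.rpow_mul (by positivity), div_eq_mul_one_div]
  norm_num [div_eq_mul_inv]

/-- The number of consecutive digits `1` that may follow, plus one, after the digit `b + 1`. -/
def nextAllowance (n m b : ℕ) : ℕ := if b = 0 then m - 1 else n

lemma exists_contracting_exponent (n : ℕ) :
    ∃ σ ρ : ℝ, 0 < σ ∧ σ < 1 ∧ 0 < ρ ∧ ρ < 1 ∧ ∀ t ∈ Icc (0 : ℝ) 1, ∀ m, 1 ≤ m → m ≤ n →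
      ∃ v ≤ ρ * (1 - (1 / 4 : ℝ) ^ m),
        HasSum (fun b => (1 - (1 / 4 : ℝ) ^ nextAllowance n m b) * branchRatio (b + 1) t ^ σ) v := by
  set Z := ∑' b : ℕ, (2 / ((b : ℝ) + 1) ^ 2) ^ (3 / 4 : ℝ)
  have hZ0 : 0 ≤ Z := tsum_nonneg fun b => by positivity
  set w : ℝ := (1 / 4) ^ n with hw
  have hw0 : 0 < w := by positivity
  have hw1 : w ≤ 1 := pow_le_one₀ (by norm_num) (by norm_num)
  set u : ℝ := w / (24 * (Z + 1)) with hu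
  have hu0 : 0 < u := by positivity
  have huZ : 4 * u * Z ≤ w / 6 := by
    rw [hu]
    rw [mul_div_assoc', div_mul_eq_mul_div, div_le_div_iff₀ (by positivity) (by norm_num)]
    nlinarith
  have hu4 : u ≤ 1 / 4 := by
    rw [hu, div_le_div_iff₀ (by positivity) (by norm_num)]
    nlinarith
  refine ⟨1 - u, 1 - w / 6, by linarith, by linarith, by linarith, by linarith,
    fun t ht m hm hmn => ?_⟩
  have h01 (k : ℕ) : 0 ≤ 1 - (1 / 4 : ℝ) ^ k ∧ 1 - (1 / 4 : ℝ) ^ k ≤ 1 :=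
    ⟨sub_nonneg.2 (pow_le_one₀ (by norm_num) (by norm_num)), by
      linarith [pow_pos (by norm_num : (0 : ℝ) < 1 / 4) k]⟩
  have hle (b : ℕ) : (1 - (1 / 4 : ℝ) ^ nextAllowance n m b) * branchRatio (b + 1) t ^ (1 - u) ≤
      (1 - (1 / 4 : ℝ) ^ nextAllowance n m b) * branchRatio (b + 1) t +
        4 * u * (2 / ((b : ℝ) + 1) ^ 2) ^ (3 / 4 : ℝ) := by
    obtain ⟨h0, h1⟩ := h01 (nextAllowance n m b)
    refine (mul_le_mul_of_nonneg_left (rpow_branchRatio_le b ht hu0.le hu4) h0).trans ?_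
    rw [mul_add]
    exact add_le_add le_rfl (mul_le_of_le_one_left (by positivity) h1)
  have hlin : HasSum (fun b : ℕ => (1 - (1 / 4 : ℝ) ^ nextAllowance n m b) *
      branchRatio (b + 1) t)
      ((1 - w) * 1 + ((1 - (1 / 4 : ℝ) ^ (m - 1)) - (1 - w)) * branchRatio 1 t) := by
    refine (((hasSum_branchRatio ht.1).mul_left (1 - w)).add (hasSum_ite_eq (0 : ℕ)
      (((1 - (1 / 4 : ℝ) ^ (m - 1)) - (1 - w)) * branchRatio 1 t))).congr_fun fun b => ?_
    unfold nextAllowance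
    split_ifs with hb
    · rw [hb, zero_add]
      ring
    · ring
  have hbound := hlin.add (summable_rpow_bound.hasSum.mul_left (4 * u))
  have hsum : Summable fun b : ℕ => (1 - (1 / 4 : ℝ) ^ nextAllowance n m b) *
      branchRatio (b + 1) t ^ (1 - u) :=
    Summable.of_nonneg_of_le (fun b => mul_nonneg (h01 _).1
      (Real.rpow_nonneg (branchRatio_pos (by omega) ht.1).le _)) hle hbound.summable
  refine ⟨_, (hasSum_le hle hsum.hasSum hbound).trans ?_, hsum.hasSum⟩
  have hc : 1 / 3 ≤ branchRatio 1 t := by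
    have := ht.1
    unfold branchRatio
    rw [div_le_div_iff₀ (by norm_num) (by positivity)]
    push_cast
    nlinarith [ht.2]
  have hy : (1 / 4 : ℝ) ^ (m - 1) = 4 * (1 / 4) ^ m := by
    obtain ⟨k, rfl⟩ : ∃ k, m = k + 1 := ⟨m - 1, by omega⟩
    rw [Nat.add_sub_cancel, pow_succ]
    ring
  have hwm : w ≤ (1 / 4) ^ m := pow_le_pow_of_le_one (by norm_num) (by norm_num) hmn
  rw [hy]
  set y : ℝ := (1 / 4) ^ m
  change _ + 4 * u * Z ≤ _
  nlinarith

/-- Points of `C n` with infinitely many digits, at least one of the first `m` of which is not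
`1`. -/
def irrationalCset (n m : ℕ) : Set ℝ :=
  {x ∈ Set.Icc 0 1 | (∀ k, (T 1)^[k] x ≠ 0) ∧ (∀ k, ∃ j < n, rcfDigit x (k + j) ≠ 1) ∧
    ∃ j < m, rcfDigit x j ≠ 1}

lemma irrationalCset_subset (n m : ℕ) :
    irrationalCset n m ⊆
      ⋃ b : ℕ, gaussBranch (b + 1) '' irrationalCset n (nextAllowance n m b) := by
  rintro x ⟨hx, hne, hC, j, hjm, hj⟩
  have hx0 : 0 < x := lt_of_le_of_ne hx.1 (hne 0).symm
  have h1x : 1 ≤ 1 / x := (one_le_div hx0).2 hx.2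
  have hfl : 1 ≤ ⌊1 / x⌋₊ := Nat.le_floor (by exact_mod_cast h1x)
  obtain ⟨b, hb⟩ : ∃ b, ⌊1 / x⌋₊ = b + 1 := ⟨⌊1 / x⌋₊ - 1, by omega⟩
  have hdig : rcfDigit x 0 = b + 1 := by
    rw [rcfDigit_zero, ← Int.natCast_floor_eq_floor (by linarith), hb]
    norm_cast
  have hTx : 1 / x = ((b + 1 : ℕ) : ℝ) + T 1 x := by
    rw [T_one]
    have h1 : (⌊1 / x⌋ : ℝ) = b + 1 := by
      rw [← rcfDigit_zero, hdig]
      push_cast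
      rfl
    have h2 := Int.floor_add_fract (1 / x)
    rw [h1] at h2
    push_cast
    exact h2.symm
  refine mem_iUnion.2 ⟨b, T 1 x, ⟨?_, fun k => hne (k + 1), fun k => ?_, ?_⟩, ?_⟩
  · rw [T_one]
    exact ⟨Int.fract_nonneg _, (Int.fract_lt_one _).le⟩
  · obtain ⟨i, hi, h⟩ := hC (k + 1)
    refine ⟨i, hi, ?_⟩
    rwa [add_right_comm, rcfDigit_add_one] at h
  · unfold nextAllowance
    split_ifs with hb0
    · rcases j with - | j
      · exact absurd (by rw [hdig, hb0]; rfl) hj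
      · exact ⟨j, by omega, hj⟩
    · obtain ⟨i, hi, h⟩ := hC 1
      refine ⟨i, hi, ?_⟩
      rwa [add_comm, rcfDigit_add_one] at h
  · rw [gaussBranch, ← hTx, one_div_one_div]

lemma irrationalCset_subset_Icc (n m : ℕ) : irrationalCset n m ⊆ Icc 0 1 := fun _ hx => hx.1

lemma pre_image_irrationalCset_le {n : ℕ} {σ ρ : ℝ} (hσ : 0 < σ) (hρ : 0 < ρ)
    (hsum : ∀ t ∈ Icc (0 : ℝ) 1, ∀ m, 1 ≤ m → m ≤ n →
      ∃ v ≤ ρ * (1 - (1 / 4 : ℝ) ^ m),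
        HasSum (fun b => (1 - (1 / 4 : ℝ) ^ nextAllowance n m b) * branchRatio (b + 1) t ^ σ) v)
    {r : ℝ≥0∞} {δ : ℝ} (hδ : ENNReal.ofReal δ ≤ r) (k : ℕ) (f : ℝ → ℝ) (D t : ℝ)
    (hf : IsCylinderMap f D t) (hD : D ≤ 2 ^ k * δ) (m : ℕ) (hm : m ≤ n) :
    OuterMeasure.mkMetric'.pre (fun s : Set ℝ => Metric.ediam s ^ σ) r
      (f '' irrationalCset n m) ≤
      ENNReal.ofReal (ρ ^ k * (2 * (1 - (1 / 4 : ℝ) ^ m) * D ^ σ)) := by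
  have h01 (k : ℕ) : 0 ≤ 1 - (1 / 4 : ℝ) ^ k :=
    sub_nonneg.2 (pow_le_one₀ (by norm_num) (by norm_num))
  induction k generalizing f D t m with
  | zero =>
    rcases Nat.eq_zero_or_pos m with rfl | hm0
    · simp [irrationalCset]
    · have hdiam : Metric.ediam (f '' irrationalCset n m) ≤ ENNReal.ofReal D := by
        refine Metric.ediam_le ?_
        rintro _ ⟨y, hy, rfl⟩ _ ⟨z, hz, rfl⟩
        rw [edist_dist, Real.dist_eq]
        exact ENNReal.ofReal_le_ofReal (hf.abs_sub_le (irrationalCset_subset_Icc n m hy)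
          (irrationalCset_subset_Icc n m hz))
      refine (OuterMeasure.mkMetric'.pre_le (hdiam.trans
        ((ENNReal.ofReal_le_ofReal (by simpa using hD)).trans hδ))).trans ?_
      refine (ENNReal.rpow_le_rpow hdiam hσ.le).trans ?_
      rw [ENNReal.ofReal_rpow_of_nonneg hf.length_pos.le hσ.le]
      refine ENNReal.ofReal_le_ofReal ?_
      have h1 : (1 / 4 : ℝ) ^ m ≤ 1 / 4 := pow_le_of_le_one (by norm_num) (by norm_num) (by omega)
      have h2 : 0 ≤ D ^ σ := Real.rpow_nonneg hf.length_pos.le _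
      nlinarith
  | succ k ih =>
    rcases Nat.eq_zero_or_pos m with rfl | hm0
    · simp [irrationalCset]
    obtain ⟨v, hv, hvsum⟩ := hsum t ⟨hf.nonneg, hf.le_one⟩ m hm0 hm
    have hc (b : ℕ) : 0 < branchRatio (b + 1) t := branchRatio_pos (by omega) hf.nonneg
    have hchild (b : ℕ) := ih (f ∘ gaussBranch (b + 1)) _ _ (hf.comp_gaussBranch (by omega))
      (by
        have h2 := branchRatio_le_half (a := b + 1) (by omega) hf.nonneg
        have h3 := hf.length_pos
        rw [pow_succ] at hD
        nlinarith) (nextAllowance n m b) (by unfold nextAllowance; split_ifs <;> omega)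
    have heq (b : ℕ) : ρ ^ k * (2 * (1 - (1 / 4 : ℝ) ^ nextAllowance n m b) *
        (D * branchRatio (b + 1) t) ^ σ) = ρ ^ k * 2 * D ^ σ *
        ((1 - (1 / 4 : ℝ) ^ nextAllowance n m b) * branchRatio (b + 1) t ^ σ) := by
      rw [Real.mul_rpow hf.length_pos.le (hc b).le]
      ring
    have hD0 : 0 ≤ D ^ σ := Real.rpow_nonneg hf.length_pos.le _
    calc OuterMeasure.mkMetric'.pre (fun s : Set ℝ => Metric.ediam s ^ σ) r
          (f '' irrationalCset n m)
        ≤ OuterMeasure.mkMetric'.pre (fun s : Set ℝ => Metric.ediam s ^ σ) r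
          (⋃ b : ℕ, (f ∘ gaussBranch (b + 1)) '' irrationalCset n (nextAllowance n m b)) := by
          refine measure_mono ((image_mono (irrationalCset_subset n m)).trans ?_)
          simp only [image_iUnion, image_comp]
          exact subset_rfl
      _ ≤ ∑' b : ℕ, ENNReal.ofReal (ρ ^ k * 2 * D ^ σ *
          ((1 - (1 / 4 : ℝ) ^ nextAllowance n m b) * branchRatio (b + 1) t ^ σ)) := by
          refine (measure_iUnion_le _).trans (ENNReal.tsum_le_tsum fun b => ?_)
          rw [← heq]
          exact hchild b
      _ = ENNReal.ofReal (ρ ^ k * 2 * D ^ σ * v) := by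
          rw [← (hvsum.mul_left (ρ ^ k * 2 * D ^ σ)).tsum_eq, ENNReal.ofReal_tsum_of_nonneg
            (fun b => mul_nonneg (by positivity)
              (mul_nonneg (h01 _) (Real.rpow_nonneg (hc b).le _)))
            (hvsum.mul_left _).summable]
      _ ≤ _ := by
          refine ENNReal.ofReal_le_ofReal ?_
          calc ρ ^ k * 2 * D ^ σ * v ≤ ρ ^ k * 2 * D ^ σ * (ρ * (1 - (1 / 4 : ℝ) ^ m)) := by
                gcongr
            _ = _ := by ring

lemma countable_iterate_T_eq_zero : {x : ℝ | ∃ k, (T 1)^[k] x = 0}.Countable := by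
  refine (countable_range ((↑) : ℚ → ℝ)).mono ?_
  rintro x ⟨k, hk⟩
  induction k generalizing x with
  | zero => exact ⟨0, by simpa using hk.symm⟩
  | succ k ih =>
    obtain ⟨q, hq⟩ := ih hk
    refine ⟨(⌊1 / x⌋ + q)⁻¹, ?_⟩
    rw [T_one] at hq
    push_cast
    rw [hq, Int.floor_add_fract, one_div, inv_inv]

theorem dimH_Cset_lt_one (n : ℕ) : dimH (Cset n) < 1 := by
  obtain ⟨σ, ρ, hσ0, hσ1, hρ0, hρ1, hsum⟩ := exists_contracting_exponent n
  have hzero : μH[σ] (irrationalCset n n) = 0 := by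
    rw [Measure.hausdorffMeasure, ← OuterMeasure.coe_mkMetric, OuterMeasure.mkMetric,
      OuterMeasure.mkMetric']
    simp only [OuterMeasure.iSup_apply, ENNReal.iSup_eq_zero]
    intro r hr
    obtain ⟨δ, hδ0, hδ⟩ : ∃ δ : ℝ, 0 < δ ∧ ENNReal.ofReal δ ≤ r := by
      refine ⟨(min r 1).toReal, ENNReal.toReal_pos (lt_min hr one_pos).ne'
        (min_lt_of_right_lt ENNReal.one_lt_top).ne, ?_⟩
      rw [ENNReal.ofReal_toReal (min_lt_of_right_lt ENNReal.one_lt_top).ne]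
      exact min_le_left _ _
    have hlim : Tendsto (fun k : ℕ => ENNReal.ofReal
        (ρ ^ k * (2 * (1 - (1 / 4 : ℝ) ^ n) * 1 ^ σ))) atTop (nhds (ENNReal.ofReal (0 *
          (2 * (1 - (1 / 4 : ℝ) ^ n) * 1 ^ σ)))) :=
      ENNReal.tendsto_ofReal ((tendsto_pow_atTop_nhds_zero_of_lt_one hρ0.le hρ1).mul_const _)
    rw [zero_mul, ENNReal.ofReal_zero] at hlim
    refine le_antisymm (ge_of_tendsto hlim ?_) bot_le
    have hk := ((tendsto_pow_atTop_atTop_of_one_lt (one_lt_two (α := ℝ))).atTop_mul_const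
      hδ0).eventually_ge_atTop 1
    filter_upwards [hk] with k hk
    simpa using pre_image_irrationalCset_le hσ0 hρ0 hsum hδ k id 1 0 isCylinderMap_id hk n le_rfl
  have hsub : Cset n ⊆ {x : ℝ | ∃ k, (T 1)^[k] x = 0} ∪ irrationalCset n n := by
    rintro x ⟨hx, hC⟩
    by_cases h : ∃ k, (T 1)^[k] x = 0
    · exact Or.inl h
    · push Not at h
      exact Or.inr ⟨hx, h, hC, by simpa using hC 0⟩
  have hdim : dimH (irrationalCset n n) ≤ σ.toNNReal :=
    dimH_le_of_hausdorffMeasure_ne_top (by rw [Real.coe_toNNReal σ hσ0.le, hzero]; simp)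
  refine (dimH_mono hsub).trans_lt ?_
  rw [dimH_union, dimH_countable countable_iterate_T_eq_zero]
  refine max_lt one_pos (hdim.trans_lt ?_)
  rw [← ENNReal.coe_one, ENNReal.coe_lt_coe]
  exact Real.toNNReal_lt_one.2 hσ1

theorem stmt14 :
    (∀ n : ℕ, 1 ≤ n → 1 / 2 < dimH (Hset n) ∧ dimH (Cset n) < 1) ∧
    Filter.Tendsto (fun n => dimH (Cset n)) Filter.atTop (nhds 1) := by
  refine ⟨fun n hn => ⟨half_lt_dimH_Hset hn, dimH_Cset_lt_one n⟩, tendsto_order.2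
    ⟨fun a ha => ?_, fun a ha => .of_forall fun n => (dimH_Cset_lt_one n).trans ha⟩⟩
  obtain ⟨s, has, hs1⟩ := exists_between ha
  have hs : s ≠ ⊤ := (hs1.trans ENNReal.one_lt_top).ne
  have hs0 : 0 < s.toReal := ENNReal.toReal_pos (bot_le.trans_lt has).ne' hs
  have hs1' : s.toReal < 1 := by
    simpa using (ENNReal.toReal_lt_toReal hs ENNReal.one_ne_top).2 hs1
  filter_upwards [eventually_le_dimH_Cset hs0 hs1'] with n hn
  rw [ENNReal.ofReal_toReal hs] at hn
  exact has.trans_le hn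
end
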